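/- arXiv:2405.06423 — 3 statements merged into one kernel-verified Lean document; each statement's English description precedes it below -/
import Mathlib

section
/- Let r > 0 and let f be a bounded measurable function on ℝ (with finite L² norm). Then ‖H_r f‖_{L²(ℝ)} ≤ 2⁹ ‖f‖_{L²(ℝ)}, where H_r f(x) = ∫_{|x−y| ≥ r} κ(x−y) f(y) dy is the truncated Hilbert-type transform. -/
open MeasureTheory
open scoped Real ENNReal

/-- The Hilbert-type kernel `κ`: `κ(x) = (1 - |x|)/(1 - e^{ix})` for `0 < |x| < 1`,
and `κ(x) = 0` otherwise. -/
noncomputable def hilbertKernel (x : ℝ) : ℂ :=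
  if 0 < |x| ∧ |x| < 1 then (1 - |x|) / (1 - Complex.exp (Complex.I * x)) else 0

/-- The truncated Hilbert-type transform `H_r f(x) = ∫_{|x - y| ≥ r} κ(x - y) f(y) dy`. -/
noncomputable def truncatedHilbertTransform (r : ℝ) (f : ℝ → ℂ) (x : ℝ) : ℂ :=
  ∫ y in {y : ℝ | r ≤ |x - y|}, hilbertKernel (x - y) * f y

section aux
open scoped FourierTransform ContDiff

lemma fourier_L2_ae {g : ℝ → ℂ} (h1 : Integrable g) (h2 : MemLp g 2 volume) :
    (𝓕 (h2.toLp g) : Lp ℂ 2 (volume : Measure ℝ)) =ᵐ[volume] 𝓕 g := by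
  have hcont : Continuous (𝓕 g) :=
    VectorFourier.fourierIntegral_continuous Real.continuous_fourierChar (by fun_prop) h1
  apply ae_eq_of_integral_contDiff_smul_eq
  · exact (Lp.memLp _).locallyIntegrable (by norm_num)
  · exact hcont.locallyIntegrable
  intro φ hφ hc
  have hc' : HasCompactSupport (fun x => (φ x : ℂ)) := hc.comp_left (g := Complex.ofReal) rfl
  have hφ' : ContDiff ℝ ∞ (fun x => (φ x : ℂ)) := Complex.ofRealCLM.contDiff.comp hφ
  let Φ : SchwartzMap ℝ ℂ := hc'.toSchwartzMap hφ'
  have hΦ : ∀ x, Φ x = (φ x : ℂ) := fun x => rfl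
  have key := congrArg (fun T => T Φ) (Lp.fourier_toTemperedDistribution_eq (h2.toLp g))
  simp only [TemperedDistribution.fourier_apply, Lp.toTemperedDistribution_apply] at key
  have e1 : ∫ x, φ x • (𝓕 (h2.toLp g) : Lp ℂ 2 (volume : Measure ℝ)) x
      = ∫ x, (𝓕 Φ) x • g x := by
    have : ∫ x, φ x • (𝓕 (h2.toLp g) : Lp ℂ 2 (volume : Measure ℝ)) x
       = ∫ x, Φ x • (𝓕 (h2.toLp g) : Lp ℂ 2 (volume : Measure ℝ)) x := by
      simp only [hΦ]; rfl
    rw [this, ← key]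
    apply integral_congr_ae
    filter_upwards [h2.coeFn_toLp] with x hx
    rw [hx]
  rw [e1]
  have := VectorFourier.integral_fourierIntegral_smul_eq_flip (L := innerₗ ℝ) (μ := volume)
    (ν := volume) (e := Real.fourierChar) (f := Φ) (g := g)
     Real.continuous_fourierChar (by fun_prop) Φ.integrable h1
  simp only [flip_innerₗ] at this
  rw [SchwartzMap.fourier_coe]
  exact this

lemma plancherel_L1_L2 {g : ℝ → ℂ} (h1 : Integrable g) (h2 : MemLp g 2 volume) :
    eLpNorm (𝓕 g) 2 volume = eLpNorm g 2 volume := by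
  rw [← eLpNorm_congr_ae (fourier_L2_ae h1 h2), ← eLpNorm_congr_ae h2.coeFn_toLp,
    ← Lp.enorm_def, ← Lp.enorm_def, ← ofReal_norm, ← ofReal_norm, Lp.norm_fourier_eq]

lemma memLp_two_of_bdd {g : ℝ → ℂ} (h1 : Integrable g) {C : ℝ} (hC : ∀ x, ‖g x‖ ≤ C) :
    MemLp g 2 volume := by
  have ht := memLp_top_of_bound h1.1 C (ae_of_all _ hC)
  rw [memLp_two_iff_integrable_sq_norm h1.1]
  have := h1.norm.bdd_mul (c := C) h1.1.norm (ae_of_all _ (by simpa using hC))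
  simpa [pow_two] using this

open scoped Convolution in
lemma conv_bound {f k : ℝ → ℂ} (hf : Integrable f) (hk : Integrable k) {A B : ℝ}
    (hfA : ∀ x, ‖f x‖ ≤ A) (hkB : ∀ ξ, ‖𝓕 k ξ‖ ≤ B) :
    AEStronglyMeasurable (fun x => ∫ y, k (x - y) * f y) volume ∧
    eLpNorm (fun x => ∫ y, k (x - y) * f y) 2 volume ≤ ENNReal.ofReal B * eLpNorm f 2 volume := by
  have e : (fun x => ∫ y, k (x - y) * f y) = f ⋆[ContinuousLinearMap.mul ℂ ℂ] k := by
    ext x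
    simp [convolution, mul_comm]
  have hi : Integrable (f ⋆[ContinuousLinearMap.mul ℂ ℂ] k) := hf.integrable_convolution _ hk
  have h2 : MemLp (f ⋆[ContinuousLinearMap.mul ℂ ℂ] k) 2 volume := by
    apply memLp_two_of_bdd hi (C := ∫ y, ‖k y‖ * A)
    intro x
    rw [← e]
    rw [← integral_sub_left_eq_self (fun y => ‖k y‖ * A) volume x]
    apply norm_integral_le_of_norm_le
    · exact (hk.norm.mul_const A).comp_sub_left x
    · refine ae_of_all _ fun y => ?_
      rw [norm_mul]
      gcongr
      exact hfA y
  rw [e]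
  refine ⟨hi.1, ?_⟩
  rw [← plancherel_L1_L2 hi h2, ← plancherel_L1_L2 hf (memLp_two_of_bdd hf hfA)]
  apply eLpNorm_le_mul_eLpNorm_of_ae_le_mul
  refine ae_of_all _ fun ξ => ?_
  rw [Real.fourier_mul_convolution_eq hf hk, norm_mul, mul_comm]
  gcongr
  exact hkB ξ

lemma denom_lb {x : ℝ} (hx : |x| < 1) : |x| / 2 ≤ ‖1 - Complex.exp (Complex.I * x)‖ := by
  rw [norm_sub_rev, Complex.norm_exp_I_mul_ofReal_sub_one, norm_mul]
  have h3 := Real.pi_gt_three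
  have h4 := Real.pi_le_four
  have := Real.mul_abs_le_abs_sin (x := x / 2) (by
    rw [abs_div]; norm_num; linarith)
  rw [abs_div, abs_two] at this
  have : 1 / 2 * (|x| / 2) ≤ 2 / π * (|x| / 2) := by
    gcongr ?_ * _
    rw [div_le_div_iff₀ (by norm_num) (by positivity)]; linarith
  simp only [Real.norm_eq_abs, abs_two]
  linarith

lemma kernel_diff {x : ℝ} (h0 : 0 < |x|) (hx : |x| < 1) :
    ‖hilbertKernel x - Complex.I * ((1 / x : ℝ) : ℂ)‖ ≤ 4 := by
  have hl := denom_lb hx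
  have hx0 : x ≠ 0 := abs_pos.1 h0
  have hD : (1 - Complex.exp (Complex.I * x)) ≠ 0 := by
    rw [← norm_pos_iff]; linarith
  have hxc : (x : ℂ) ≠ 0 := by exact_mod_cast hx0
  have hR := Complex.norm_exp_sub_one_sub_id_le (x := Complex.I * x) (by
    simp; exact hx.le)
  have e : hilbertKernel x - Complex.I * ((1 / x : ℝ) : ℂ) =
     (-x * |x| + Complex.I * (Complex.exp (Complex.I * x) - 1 - Complex.I * x)) /
       (x * (1 - Complex.exp (Complex.I * x))) := by
    rw [hilbertKernel, if_pos ⟨h0, hx⟩]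
    push_cast
    field_simp
    ring_nf
    simp only [Complex.I_sq]
    ring
  rw [e, norm_div, div_le_iff₀ (by rw [norm_mul]; exact mul_pos (by simpa) (by simpa using hD))]
  have hn : ‖(-x * |x| + Complex.I * (Complex.exp (Complex.I * x) - 1 - Complex.I * x) : ℂ)‖
      ≤ |x| * |x| + |x| ^ 2 := by
    refine (norm_add_le _ _).trans ?_
    gcongr
    · simp
    · simpa using hR
  rw [norm_mul, Complex.norm_real, Real.norm_eq_abs]
  nlinarith

lemma kernel_bound {x : ℝ} (h0 : 0 < |x|) : ‖hilbertKernel x‖ ≤ 2 / |x| := by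
  rw [hilbertKernel]
  split_ifs with h
  · have hl := denom_lb h.2
    rw [norm_div]
    have : ‖(1 - (|x| : ℝ) : ℂ)‖ ≤ 1 := by
      rw [← Complex.ofReal_one, ← Complex.ofReal_sub, Complex.norm_real, Real.norm_eq_abs, abs_le]
      constructor <;> linarith [h.2]
    calc _ ≤ 1 / (|x| / 2) := by gcongr
      _ = _ := by field_simp
  · simp; positivity

lemma hK_meas : Measurable hilbertKernel := by
  unfold hilbertKernel
  apply Measurable.ite
  · have h1 : MeasurableSet {x : ℝ | 0 < |x|} := measurableSet_lt (by fun_prop) (by fun_prop)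
    have h2 : MeasurableSet {x : ℝ | |x| < 1} := measurableSet_lt (by fun_prop) (by fun_prop)
    exact h1.inter h2
  · fun_prop
  · fun_prop


lemma sin_far {a s t : ℝ} (ha : 0 < a) (hs : 0 < s) (hst : s ≤ t) (h : 1 ≤ a * s) :
    |∫ x in s..t, Real.sin (a * x) / x| ≤ 3 := by
  have hpos : ∀ x ∈ Set.uIcc s t, 0 < x := fun x hx => by
    rw [Set.uIcc_of_le hst] at hx; linarith [hx.1]
  have hd : ∀ x ∈ Set.uIcc s t, HasDerivAt (fun x => -Real.cos (a * x) / (a * x))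
      (Real.sin (a * x) / x + Real.cos (a * x) / (a * x ^ 2)) x := by
    intro x hx
    have := hpos x hx
    have h1 : HasDerivAt (fun x : ℝ => a * x) a x := by simpa using (hasDerivAt_id x).const_mul a
    have h2 := (h1.cos.neg).div h1 (by positivity)
    refine HasDerivAt.congr_deriv (f' := _) h2 ?_
    simp only [Pi.neg_apply]
    field_simp
    ring
  have hc1 : ContinuousOn (fun x => Real.sin (a * x) / x) (Set.uIcc s t) :=
    ContinuousOn.div (by fun_prop) (by fun_prop) fun x hx => (hpos x hx).ne'
  have hc2 : ContinuousOn (fun x => Real.cos (a * x) / (a * x ^ 2)) (Set.uIcc s t) :=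
    ContinuousOn.div (by fun_prop) (by fun_prop) fun x hx => by
      have := hpos x hx; positivity
  have hc3 : ContinuousOn (fun x : ℝ => 1 / (a * x ^ 2)) (Set.uIcc s t) :=
    ContinuousOn.div (by fun_prop) (by fun_prop) fun x hx => by
      have := hpos x hx; positivity
  have I1 := intervalIntegral.integral_eq_sub_of_hasDerivAt hd
    (hc1.intervalIntegrable.add hc2.intervalIntegrable)
  rw [intervalIntegral.integral_add hc1.intervalIntegrable hc2.intervalIntegrable] at I1
  have I3 := intervalIntegral.integral_eq_sub_of_hasDerivAt
    (f := fun x => -1 / (a * x)) (f' := fun x : ℝ => 1 / (a * x ^ 2)) (a := s) (b := t) (by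
      intro x hx
      have := hpos x hx
      have h1 : HasDerivAt (fun x : ℝ => a * x) a x := by simpa using (hasDerivAt_id x).const_mul a
      have h2 := (hasDerivAt_const x (-1 : ℝ)).div h1 (by positivity)
      refine HasDerivAt.congr_deriv (f' := _) h2 ?_
      field_simp
      ring) hc3.intervalIntegrable
  have I2 : |∫ x in s..t, Real.cos (a * x) / (a * x ^ 2)| ≤ ∫ x in s..t, 1 / (a * x ^ 2) := by
    have := intervalIntegral.norm_integral_le_of_norm_le (f := fun x => Real.cos (a * x) / (a * x ^ 2))
      (g := fun x => 1 / (a * x ^ 2)) (a := s) (b := t) (μ := volume) hst (by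
      refine ae_of_all _ fun x hx => ?_
      have : 0 < x := by linarith [hx.1]
      rw [Real.norm_eq_abs, abs_div, abs_of_pos (show 0 < a * x ^ 2 by positivity)]
      gcongr
      exact Real.abs_cos_le_one _) hc3.intervalIntegrable
    simpa using this
  have ht : 0 < t := by linarith
  have b1 : ∀ y, 0 < y → s ≤ y → |-Real.cos (a * y) / (a * y)| ≤ 1 := by
    intro y hy hsy
    have : 1 ≤ a * y := h.trans (by gcongr)
    rw [abs_div, abs_neg, abs_of_pos (show 0 < a * y by positivity), div_le_one (by positivity)]
    exact (Real.abs_cos_le_one _).trans this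
  have b2 : 1 / (a * s) ≤ 1 := by rw [div_le_one (by positivity)]; exact h
  have b3 : 0 < 1 / (a * t) := by positivity
  have B1 := abs_le.1 (b1 s hs le_rfl)
  have B2 := abs_le.1 (b1 t ht hst)
  rw [I3] at I2
  have B3 := abs_le.1 I2
  rw [neg_div, neg_div] at B3
  rw [abs_le]
  constructor <;> linarith [B3.1, B3.2, B1.1, B1.2, B2.1, B2.2]

lemma sin_near {a s t : ℝ} (ha : 0 < a) (hs : 0 < s) (hst : s ≤ t) (h : a * t ≤ 1) :
    |∫ x in s..t, Real.sin (a * x) / x| ≤ 1 := by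
  have := intervalIntegral.norm_integral_le_of_norm_le_const (f := fun x => Real.sin (a * x) / x)
    (C := a) (a := s) (b := t) (by
    intro x hx
    rw [Set.uIoc_of_le hst] at hx
    have : 0 < x := by linarith [hx.1]
    rw [Real.norm_eq_abs, abs_div, abs_of_pos this, div_le_iff₀ this]
    have := Real.abs_sin_le_abs (x := a * x)
    rwa [abs_of_pos (show 0 < a * x by positivity)] at this)
  rw [abs_of_nonneg (by linarith : 0 ≤ t - s)] at this
  rw [Real.norm_eq_abs] at this
  nlinarith

lemma sin_pos {a s t : ℝ} (ha : 0 < a) (hs : 0 < s) (hst : s ≤ t) :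
    |∫ x in s..t, Real.sin (a * x) / x| ≤ 4 := by
  rcases le_or_gt 1 (a * s) with h | h
  · linarith [sin_far ha hs hst h]
  rcases le_or_gt (a * t) 1 with h' | h'
  · linarith [sin_near ha hs hst h']
  have h1 : s ≤ 1 / a := by rw [le_div_iff₀ ha]; linarith
  have h2 : 1 / a ≤ t := by rw [div_le_iff₀ ha]; linarith
  have hc : ∀ u v : ℝ, 0 < u → 0 < v → IntervalIntegrable (fun x => Real.sin (a * x) / x) volume u v := by
    intro u v hu hv
    apply ContinuousOn.intervalIntegrable
    refine ContinuousOn.div (by fun_prop) (by fun_prop) fun x hx => ?_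
    have := hx.1
    have : 0 < u ⊓ v := lt_min hu hv
    linarith
  have ha' : 0 < 1 / a := by positivity
  rw [← intervalIntegral.integral_add_adjacent_intervals (hc s (1 / a) hs ha')
    (hc (1 / a) t ha' (by linarith))]
  refine (abs_add_le _ _).trans ?_
  have := sin_near ha hs h1 (by field_simp; rfl)
  have := sin_far ha ha' h2 (by field_simp; rfl)
  linarith

lemma sin_all (a : ℝ) {s t : ℝ} (hs : 0 < s) (hst : s ≤ t) :
    |∫ x in s..t, Real.sin (a * x) / x| ≤ 4 := by
  rcases lt_trichotomy a 0 with h | h | h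
  · have := sin_pos (a := -a) (by linarith) hs hst
    simpa [neg_mul, Real.sin_neg, neg_div, intervalIntegral.integral_neg] using this
  · simp [h]
  · exact sin_pos h hs hst

noncomputable def truncK (r x : ℝ) : ℂ := if r ≤ |x| then hilbertKernel x else 0

noncomputable def pK (r x : ℝ) : ℝ := if r ≤ |x| ∧ |x| < 1 then 1 / x else 0

lemma truncK_meas (r : ℝ) : Measurable (truncK r) := by
  unfold truncK
  exact Measurable.ite (measurableSet_le (by fun_prop) (by fun_prop)) hK_meas measurable_const

lemma pK_meas (r : ℝ) : Measurable (pK r) := by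
  unfold pK
  apply Measurable.ite
  · have h1 : MeasurableSet {x : ℝ | r ≤ |x|} := measurableSet_le (by fun_prop) (by fun_prop)
    have h2 : MeasurableSet {x : ℝ | |x| < 1} := measurableSet_lt (by fun_prop) (by fun_prop)
    exact h1.inter h2
  · fun_prop
  · fun_prop

lemma integrable_of_bdd_supp {g : ℝ → ℂ} (hg : AEStronglyMeasurable g volume) {C R : ℝ}
    (hC : ∀ x, ‖g x‖ ≤ C) (h0 : ∀ x, R < |x| → g x = 0) : Integrable g := by
  have h : IntegrableOn g (Set.Icc (-R) R) :=
    Measure.integrableOn_of_bounded (M := C) (by simp) hg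
      (ae_of_all _ hC)
  rw [integrableOn_iff_integrable_of_support_subset] at h
  · exact h
  intro x hx
  by_contra hx'
  exact hx (h0 x (by
    by_contra hh
    exact hx' (abs_le.1 (not_lt.1 hh))))

lemma truncK_zero {r x : ℝ} (h : 1 ≤ |x|) : truncK r x = 0 := by
  simp only [truncK, hilbertKernel]
  split_ifs with h1 h2
  · exact absurd h2.2 (not_lt.2 h)
  · rfl
  · rfl

lemma truncK_bdd {r : ℝ} (hr : 0 < r) (x : ℝ) : ‖truncK r x‖ ≤ 2 / r := by
  rw [truncK]
  split_ifs with h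
  · refine (kernel_bound (hr.trans_le h)).trans ?_
    gcongr
  · simp; positivity

lemma truncK_int {r : ℝ} (hr : 0 < r) : Integrable (truncK r) :=
  integrable_of_bdd_supp (truncK_meas r).aestronglyMeasurable (truncK_bdd hr) (R := 1)
    fun _ h => truncK_zero h.le

lemma pK_int {r : ℝ} (hr : 0 < r) : Integrable (fun x => (pK r x : ℂ)) := by
  refine integrable_of_bdd_supp (C := 1 / r) (R := 1)
    (Complex.measurable_ofReal.comp (pK_meas r)).aestronglyMeasurable ?_ ?_
  · intro x
    rw [Complex.norm_real, pK]
    split_ifs with h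
    · rw [norm_div, norm_one, Real.norm_eq_abs]
      gcongr
      exact h.1
    · simp; positivity
  · intro x hx
    rw [pK, if_neg (fun h => by linarith [h.2])]
    simp

lemma pK_odd (r x : ℝ) : pK r (-x) = - pK r x := by
  simp only [pK, abs_neg]
  split_ifs
  · rw [one_div, one_div, inv_neg]
  · simp

lemma sin_pK (r a : ℝ) (hr : 0 < r) : |∫ x, Real.sin (a * x) * pK r x| ≤ 8 := by
  have e : ∀ x, Real.sin (a * x) * pK r x = (fun y => Real.sin (a * y) * pK r y) |x| := by
    intro x
    rcases abs_choice x with h | h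
    · simp only [h]
    · simp only [h, pK_odd, mul_neg, Real.sin_neg, neg_mul, neg_neg]
  rw [integral_congr_ae (ae_of_all _ e), integral_comp_abs (f := fun y => Real.sin (a * y) * pK r y)]
  rcases le_or_gt 1 r with h | h
  · have : ∀ y, pK r y = 0 := fun y => by
      rw [pK, if_neg (fun h' => by linarith [h'.1, h'.2])]
    simp [this]
  · have e2 : ∫ y in Set.Ioi 0, Real.sin (a * y) * pK r y
        = ∫ y in r..1, Real.sin (a * y) / y := by
      rw [intervalIntegral.integral_of_le h.le, ← integral_Ico_eq_integral_Ioc,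
        ← integral_indicator measurableSet_Ioi, ← integral_indicator measurableSet_Ico]
      congr 1
      ext y
      simp only [Set.indicator, Set.mem_Ioi, Set.mem_Ico, pK]
      by_cases hy : 0 < y
      · simp only [abs_of_pos hy, hy, if_true]
        split_ifs <;> simp [div_eq_mul_inv]
      · rw [if_neg hy, if_neg (fun h' => hy (by linarith [h'.1]))]
    rw [e2, abs_mul, abs_two]
    linarith [sin_all a hr h.le]

lemma fourier_pK {r : ℝ} (hr : 0 < r) (a : ℝ) :
    ‖∫ x, Complex.exp (((-a * x : ℝ) : ℂ) * Complex.I) * (pK r x : ℂ)‖ ≤ 8 := by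
  have hi : ∀ b : ℝ, Integrable (fun x : ℝ =>
      Complex.exp (((b * x : ℝ) : ℂ) * Complex.I) * (pK r x : ℂ)) := by
    intro b
    refine (pK_int hr).bdd_mul (c := 1) ?_ ?_
    · exact Continuous.aestronglyMeasurable (by fun_prop)
    · exact ae_of_all _ fun x => (Complex.norm_exp_ofReal_mul_I _).le
  set J := ∫ x, Complex.exp (((-a * x : ℝ) : ℂ) * Complex.I) * (pK r x : ℂ) with hJ
  have h1 : J = - ∫ x, Complex.exp (((a * x : ℝ) : ℂ) * Complex.I) * (pK r x : ℂ) := by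
    rw [hJ, ← integral_neg_eq_self, ← integral_neg]
    congr 1
    ext x
    rw [pK_odd]
    push_cast
    ring_nf
  have h2 : 2 * J = -(2 * Complex.I) * ((∫ x, Real.sin (a * x) * pK r x : ℝ) : ℂ) := by
    have : 2 * J = J + J := by ring
    rw [this]
    nth_rw 2 [h1]
    rw [hJ, ← sub_eq_add_neg, ← integral_sub (hi _) (hi _), ← integral_complex_ofReal,
      ← integral_const_mul]
    congr 1
    ext x
    push_cast
    rw [Complex.sin]
    ring_nf
    simp only [Complex.I_sq]
    ring_nf
  have h3 := congrArg norm h2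
  have h4 := sin_pK r a hr
  simp only [norm_mul, norm_neg, Complex.norm_I, Complex.norm_real, Real.norm_eq_abs] at h3
  norm_num at h3
  rw [h3]; exact h4

lemma fourier_truncK {r : ℝ} (hr : 0 < r) (ξ : ℝ) : ‖𝓕 (truncK r) ξ‖ ≤ 16 := by
  rw [Real.fourier_real_eq_integral_exp_smul]
  set a := 2 * π * ξ with ha
  let E : ℝ → ℂ := fun x => Complex.exp (((-a * x : ℝ) : ℂ) * Complex.I)
  have hEn : ∀ x, ‖E x‖ = 1 := fun x => Complex.norm_exp_ofReal_mul_I _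
  have hEc : Continuous E := by fun_prop
  have e : ∀ v : ℝ, Complex.exp (((-2 * π * v * ξ : ℝ) : ℂ) * Complex.I) • truncK r v
     = Complex.I * (E v * (pK r v : ℂ)) + E v * (truncK r v - Complex.I * (pK r v : ℂ)) := by
    intro v
    have : -2 * π * v * ξ = -a * v := by rw [ha]; ring
    rw [this, smul_eq_mul]
    change E v * _ = _
    ring
  have hb : Integrable (fun v => truncK r v - Complex.I * (pK r v : ℂ)) :=
    (truncK_int hr).sub ((pK_int hr).const_mul _)
  have hm : ∀ g : ℝ → ℂ, Integrable g → Integrable (fun v => E v * g v) := fun g hg =>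
    hg.bdd_mul (c := 1) hEc.aestronglyMeasurable (ae_of_all _ fun x => (hEn x).le)
  rw [integral_congr_ae (ae_of_all _ e), integral_add ((hm _ (pK_int hr)).const_mul _) (hm _ hb),
    integral_const_mul]
  refine (norm_add_le _ _).trans ?_
  have A1 : ‖Complex.I * ∫ v, E v * (pK r v : ℂ)‖ ≤ 8 := by
    rw [norm_mul, Complex.norm_I, one_mul]
    exact fourier_pK hr a
  have A2 : ‖∫ v, E v * (truncK r v - Complex.I * (pK r v : ℂ))‖ ≤ 8 := by
    have hI : ∫ v, (Set.Icc (-1 : ℝ) 1).indicator (fun _ => (4 : ℝ)) v = 8 := by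
      rw [integral_indicator measurableSet_Icc]
      simp
      norm_num
    rw [← hI]
    apply norm_integral_le_of_norm_le
    · rw [integrable_indicator_iff measurableSet_Icc]
      simp
    · refine ae_of_all _ fun v => ?_
      rw [norm_mul, hEn, one_mul]
      by_cases h1 : |v| < 1
      · rw [Set.indicator_of_mem (by exact abs_le.1 h1.le)]
        by_cases h2 : r ≤ |v|
        · rw [truncK, pK, if_pos h2, if_pos ⟨h2, h1⟩]
          exact kernel_diff (hr.trans_le h2) h1
        · rw [truncK, pK, if_neg h2, if_neg (fun h => h2 h.1)]
          simp
      · rw [truncK_zero (not_lt.1 h1), pK, if_neg (fun h => h1 h.2)]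
        simp only [Complex.ofReal_zero, mul_zero, sub_zero, norm_zero]
        exact Set.indicator_nonneg (fun _ _ => by norm_num) _
  linarith

lemma trunc_eq (r : ℝ) (f : ℝ → ℂ) (x : ℝ) :
    truncatedHilbertTransform r f x = ∫ y, truncK r (x - y) * f y := by
  rw [truncatedHilbertTransform, ← integral_indicator (measurableSet_le (by fun_prop) (by fun_prop))]
  congr 1
  ext y
  simp only [Set.indicator, Set.mem_ofPred_eq, truncK]
  split_ifs <;> simp

end aux

/-- **L² bound for the truncated Hilbert transform**: for `r > 0` and bounded measurable `f`,
`‖H_r f‖_{L²(ℝ)} ≤ 2⁹ ‖f‖_{L²(ℝ)}`. -/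
theorem Hilbert_strong_2_2 {r : ℝ} (hr : 0 < r) {f : ℝ → ℂ} (hf_meas : Measurable f)
    (hf_bdd : ∃ C, ∀ x, ‖f x‖ ≤ C) :
    eLpNorm (truncatedHilbertTransform r f) 2 volume ≤ 2 ^ 9 * eLpNorm f 2 volume := by
  obtain ⟨C, hC⟩ := hf_bdd
  have hC0 : 0 ≤ C := (norm_nonneg _).trans (hC 0)
  let F : ℕ → ℝ → ℂ := fun n => (Set.Icc (-(n : ℝ)) n).indicator f
  have hFC : ∀ n x, ‖F n x‖ ≤ C := fun n x => (norm_indicator_le_norm_self _ _).trans (hC x)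
  have hFi : ∀ n, Integrable (F n) := fun n =>
    integrable_of_bdd_supp (hf_meas.indicator measurableSet_Icc).aestronglyMeasurable (hFC n)
      (R := n) fun x hx => Set.indicator_of_notMem (fun h => by
        have := abs_le.2 h
        linarith) _
  have key := fun n => conv_bound (hFi n) (truncK_int hr) (hFC n) (fourier_truncK hr)
  have hlim : ∀ x, Filter.Tendsto (fun n => ∫ y, truncK r (x - y) * F n y) Filter.atTop
      (nhds (truncatedHilbertTransform r f x)) := by
    intro x
    apply tendsto_const_nhds.congr'
    obtain ⟨N, hN⟩ := exists_nat_ge (|x| + 1)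
    filter_upwards [Filter.eventually_ge_atTop N] with n hn
    rw [trunc_eq]
    congr 1
    ext y
    rcases le_or_gt 1 |x - y| with h | h
    · simp [truncK_zero h]
    · congr 1
      refine (Set.indicator_of_mem ?_ f).symm
      have hn' : (N : ℝ) ≤ n := by exact_mod_cast hn
      have : |y| ≤ |x| + |x - y| := by
        have := abs_sub_abs_le_abs_sub y x
        rw [abs_sub_comm] at this
        linarith
      exact abs_le.1 (by linarith)
  have hle := Lp.eLpNorm_lim_le_liminf_eLpNorm (p := 2) (μ := (volume : Measure ℝ))
    (fun n => (key n).1) (truncatedHilbertTransform r f) (ae_of_all _ hlim)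
  refine hle.trans ?_
  have hb : ∀ n, eLpNorm (fun x => ∫ y, truncK r (x - y) * F n y) 2 volume
      ≤ 2 ^ 9 * eLpNorm f 2 volume := by
    intro n
    refine (key n).2.trans ?_
    gcongr
    · rw [show (16 : ℝ) = ((16 : ℕ) : ℝ) by norm_num, ENNReal.ofReal_natCast]
      norm_num
    · exact eLpNorm_indicator_le _
  refine (Filter.liminf_le_liminf (Filter.Eventually.of_forall hb)).trans ?_
  simp
end

section
/- Let a ≥ 4 be an integer, (X,ρ,μ,a) a doubling metric measure space, and K a two-sided Calderón–Zygmund kernel on it. Let r > 0 and assume that ‖T_r g‖_{L²(μ)} ≤ 2^{a³} ‖g‖_{L²(μ)} for every bounded measurable g supported on a set of finite measure. Then for every bounded measurable f supported on a set of finite measure and every α > 0, μ({x ∈ X : |T_r f(x)| > α}) ≤ (2^{a³+21a}/α) ∫ |f| dμ. -/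
open MeasureTheory Metric
open scoped ENNReal NNReal

/-- The truncated singular integral operator
`T_r f(x) = ∫_{ρ(x,y) ≥ r} K(x,y) f(y) dμ(y)`. -/
noncomputable def czOperator {X : Type*} [MetricSpace X] [MeasurableSpace X]
    (μ : MeasureTheory.Measure X) (K : X → X → ℂ) (r : ℝ) (f : X → ℂ) (x : X) : ℂ :=
  ∫ y in {y | r ≤ dist x y}, K x y * f y ∂μ


section CZHelpers

set_option linter.unusedSectionVars false

open Set Filter Topology

variable {X : Type*} [MetricSpace X] [MeasurableSpace X] [BorelSpace X]
  {μ : Measure X} {a : ℕ}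

/-- The doubling property. -/
def CZDoubling (μ : Measure X) (a : ℕ) : Prop :=
  ∀ (x : X) (R : ℝ), 0 < R → μ (ball x (2 * R)) ≤ 2 ^ a * μ (ball x R)

lemma cz_ball_pow (D : CZDoubling μ a) (x : X) {R : ℝ} (hR : 0 < R) (n : ℕ) :
    μ (ball x (2 ^ n * R)) ≤ 2 ^ (n * a) * μ (ball x R) := by
  induction n with
  | zero => simp
  | succ n ih =>
    have h1 := D x (2 ^ n * R) (by positivity)
    have e : (2 : ℝ) ^ (n + 1) * R = 2 * (2 ^ n * R) := by ring
    rw [e]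
    calc _ ≤ 2 ^ a * μ (ball x (2 ^ n * R)) := h1
      _ ≤ 2 ^ a * (2 ^ (n * a) * μ (ball x R)) := by gcongr
      _ = _ := by rw [← mul_assoc, ← pow_add]; congr 2; ring

lemma cz_ball_pos (D : CZDoubling μ a) (hμ : μ ≠ 0) (x : X) {R : ℝ} (hR : 0 < R) :
    0 < μ (ball x R) := by
  rw [pos_iff_ne_zero]
  intro h0
  apply hμ
  rw [← Measure.measure_univ_eq_zero]
  have : (univ : Set X) = ⋃ n : ℕ, ball x (2 ^ n * R) := by
    symm
    rw [eq_univ_iff_forall]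
    intro y
    obtain ⟨n, hn⟩ := pow_unbounded_of_one_lt (dist y x / R) (by norm_num : (1 : ℝ) < 2)
    refine mem_iUnion.2 ⟨n, ?_⟩
    rw [mem_ball]
    rwa [div_lt_iff₀ hR] at hn
  rw [this, measure_iUnion_null_iff]
  intro n
  have := cz_ball_pow D x hR n
  rw [h0, mul_zero] at this
  exact le_antisymm this zero_le

lemma cz_ball_fin [IsLocallyFiniteMeasure μ] (D : CZDoubling μ a) (x : X) (R : ℝ) :
    μ (ball x R) < ⊤ := by
  obtain ⟨s, hs, hs'⟩ := μ.finiteAt_nhds x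
  obtain ⟨ε, hε, hεs⟩ := Metric.mem_nhds_iff.1 hs
  obtain ⟨n, hn⟩ := pow_unbounded_of_one_lt (R / ε) (by norm_num : (1 : ℝ) < 2)
  rw [div_lt_iff₀ hε] at hn
  calc μ (ball x R) ≤ μ (ball x (2 ^ n * ε)) := measure_mono (ball_subset_ball hn.le)
    _ ≤ _ := cz_ball_pow D x hε n
    _ < ⊤ := ENNReal.mul_lt_top (ENNReal.pow_lt_top (by simp))
      ((measure_mono hεs).trans_lt hs')

lemma cz_sigmaFinite [IsLocallyFiniteMeasure μ] (D : CZDoubling μ a) : SigmaFinite μ := by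
  rcases isEmpty_or_nonempty X with h | ⟨⟨x⟩⟩
  · have : μ = 0 := Measure.eq_zero_of_isEmpty μ
    rw [this]; infer_instance
  refine ⟨⟨⟨fun n : ℕ => ball x n, fun _ => trivial, fun n => cz_ball_fin D x n, ?_⟩⟩⟩
  exact iUnion_ball_nat x

lemma cz_countable [IsLocallyFiniteMeasure μ] (D : CZDoubling μ a) (hμ : μ ≠ 0)
    {ι : Type*} (u : Set ι) (x : ι → X) (B : ι → Set X) (s : ι → ℝ) (hs : ∀ i ∈ u, 0 < s i)
    (hB : ∀ i ∈ u, ball (x i) (s i) ⊆ B i) (hu : u.PairwiseDisjoint B) : u.Countable := by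
  have := cz_sigmaFinite D
  have h := Measure.countable_meas_pos_of_disjoint_iUnion (μ := μ)
    (As := fun i : u => ball (x i) (s i)) (fun i => measurableSet_ball) (by
      intro i j hij
      exact (hu i.2 j.2 (fun h => hij (Subtype.ext h))).mono (hB _ i.2) (hB _ j.2))
  have h2 : {i : u | 0 < μ (ball (x i) (s i))} = univ := by
    ext i; simp [cz_ball_pos D hμ _ (hs i i.2)]
  rw [h2, countable_univ_iff] at h
  exact h

lemma cz_secondCountable [IsLocallyFiniteMeasure μ] (D : CZDoubling μ a) (hμ : μ ≠ 0) :
    SecondCountableTopology X := by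
  apply Metric.secondCountable_of_almost_dense_set
  intro ε hε
  obtain ⟨u, -, hu, hc⟩ := Vitali.exists_disjoint_subfamily_covering_enlargement_ball
    (univ : Set X) id (fun _ => ε / 4) (ε / 4) (fun _ _ => le_rfl) 4 (by norm_num)
  refine ⟨u, cz_countable D hμ u id _ (fun _ => ε / 4) (fun _ _ => by positivity)
    (fun i _ => subset_rfl) hu, fun x => ?_⟩
  obtain ⟨y, hy, hxy⟩ := hc x (mem_univ x)
  refine ⟨y, hy, ?_⟩
  have := hxy (mem_ball_self (by positivity))
  rw [mem_ball] at this
  simp at this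
  linarith

lemma cz_isUnifLocDoubling (D : CZDoubling μ a) : IsUnifLocDoublingMeasure μ := by
  refine ⟨⟨2 ^ (2 * a), ?_⟩⟩
  filter_upwards [self_mem_nhdsWithin] with ε hε x
  have hε : 0 < ε := hε
  calc μ (closedBall x (2 * ε)) ≤ μ (ball x (2 ^ 2 * ε)) :=
        measure_mono (closedBall_subset_ball (by linarith))
    _ ≤ _ := cz_ball_pow D x hε 2
    _ ≤ _ := by
      push_cast
      gcongr
      exact ball_subset_closedBall

/-- The level set of the uncentred maximal function. -/
def czOmega (μ : Measure X) (F : X → ℝ≥0∞) (l : ℝ≥0∞) : Set X :=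
  {x | ∃ y R, x ∈ ball y R ∧ l * μ (closedBall y R) < ∫⁻ z in closedBall y R, F z ∂μ}

lemma cz_omega_isOpen (F : X → ℝ≥0∞) (l : ℝ≥0∞) : IsOpen (czOmega μ F l) := by
  have : czOmega μ F l = ⋃ y, ⋃ R, ⋃ (_ : l * μ (closedBall y R) < ∫⁻ z in closedBall y R, F z ∂μ),
      ball y R := by
    ext x; simp only [czOmega, mem_setOf_eq, mem_iUnion]
    constructor
    · rintro ⟨y, R, h1, h2⟩; exact ⟨y, R, h2, h1⟩
    · rintro ⟨y, R, h1, h2⟩; exact ⟨y, R, h2, h1⟩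
  rw [this]
  exact isOpen_iUnion fun y => isOpen_iUnion fun R => isOpen_iUnion fun _ => isOpen_ball

lemma cz_omega_measure [IsLocallyFiniteMeasure μ] (D : CZDoubling μ a) (hμ : μ ≠ 0)
    (F : X → ℝ≥0∞) {l : ℝ≥0∞} (hl : l ≠ 0) (hl' : l ≠ ⊤) :
    μ (czOmega μ F l) ≤ 2 ^ (3 * a) / l * ∫⁻ z, F z ∂μ := by
  let A : ℕ → Set X := fun n => {x | ∃ y R, x ∈ ball y R ∧
    l * μ (closedBall y R) < ∫⁻ z in closedBall y R, F z ∂μ ∧ R ≤ n}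
  have hA : czOmega μ F l = ⋃ n, A n := by
    ext x
    simp only [czOmega, A, mem_setOf_eq, mem_iUnion]
    constructor
    · rintro ⟨y, R, h1, h2⟩
      obtain ⟨n, hn⟩ := exists_nat_ge R
      exact ⟨n, y, R, h1, h2, hn⟩
    · rintro ⟨n, y, R, h1, h2, hn⟩
      exact ⟨y, R, h1, h2⟩
  have hmono : Monotone A := by
    rintro m n hmn x ⟨y, R, h1, h2, h3⟩
    exact ⟨y, R, h1, h2, h3.trans (by exact_mod_cast hmn)⟩
  rw [hA, hmono.measure_iUnion]
  refine iSup_le fun n => ?_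
  let t : Set (X × ℝ) := {p | 0 < p.2 ∧
    l * μ (closedBall p.1 p.2) < ∫⁻ z in closedBall p.1 p.2, F z ∂μ ∧ p.2 ≤ n}
  obtain ⟨u, hut, hu, hc⟩ := Vitali.exists_disjoint_subfamily_covering_enlargement_closedBall
    t (fun p => p.1) (fun p => p.2) n (fun p hp => hp.2.2) 4 (by norm_num)
  have huc : u.Countable := cz_countable D hμ u (fun p => p.1) _ (fun p => p.2)
    (fun i hi => (hut hi).1) (fun i _ => ball_subset_closedBall) hu
  have hsub : A n ⊆ ⋃ p ∈ u, closedBall p.1 (4 * p.2) := by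
    rintro x ⟨y, R, h1, h2, h3⟩
    have hR : 0 < R := dist_nonneg.trans_lt (mem_ball.1 h1)
    obtain ⟨b, hb, hb'⟩ := hc (y, R) ⟨hR, h2, h3⟩
    exact mem_biUnion hb (hb' (ball_subset_closedBall h1))
  have := huc.to_subtype
  have key : ∀ p : u, μ (closedBall p.1.1 (4 * p.1.2)) ≤
      2 ^ (3 * a) / l * ∫⁻ z in closedBall p.1.1 p.1.2, F z ∂μ := by
    intro p
    obtain ⟨h1, h2, h3⟩ := hut p.2
    have h4 : μ (closedBall p.1.1 p.1.2) ≤ (∫⁻ z in closedBall p.1.1 p.1.2, F z ∂μ) / l := by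
      rw [ENNReal.le_div_iff_mul_le (Or.inl hl) (Or.inl hl'), mul_comm]
      exact h2.le
    calc μ (closedBall p.1.1 (4 * p.1.2)) ≤ μ (ball p.1.1 (2 ^ 3 * p.1.2)) :=
          measure_mono (closedBall_subset_ball (by linarith))
      _ ≤ 2 ^ (3 * a) * μ (ball p.1.1 p.1.2) := cz_ball_pow D _ h1 3
      _ ≤ 2 ^ (3 * a) * μ (closedBall p.1.1 p.1.2) := by
          gcongr; exact ball_subset_closedBall
      _ ≤ 2 ^ (3 * a) * ((∫⁻ z in closedBall p.1.1 p.1.2, F z ∂μ) / l) := by gcongr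
      _ = _ := by rw [div_eq_mul_inv, div_eq_mul_inv]; ring
  calc μ (A n) ≤ μ (⋃ p ∈ u, closedBall p.1 (4 * p.2)) := measure_mono hsub
    _ = μ (⋃ p : u, closedBall p.1.1 (4 * p.1.2)) := by rw [biUnion_eq_iUnion]
    _ ≤ ∑' p : u, μ (closedBall p.1.1 (4 * p.1.2)) := measure_iUnion_le _
    _ ≤ ∑' p : u, 2 ^ (3 * a) / l * ∫⁻ z in closedBall p.1.1 p.1.2, F z ∂μ :=
        ENNReal.tsum_le_tsum key
    _ = 2 ^ (3 * a) / l * ∑' p : u, ∫⁻ z in closedBall p.1.1 p.1.2, F z ∂μ :=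
        ENNReal.tsum_mul_left
    _ = 2 ^ (3 * a) / l * ∫⁻ z in ⋃ p : u, closedBall p.1.1 p.1.2, F z ∂μ := by
        rw [lintegral_iUnion (fun p => measurableSet_closedBall)]
        intro i j hij
        exact hu i.2 j.2 (fun h => hij (Subtype.ext h))
    _ ≤ _ := by gcongr; exact Measure.restrict_le_self

lemma cz_ae_le [IsLocallyFiniteMeasure μ] (D : CZDoubling μ a) (hμ : μ ≠ 0)
    {F : X → ℝ≥0∞} (hF : Measurable F) (hF' : ∫⁻ z, F z ∂μ ≠ ⊤) (l : ℝ≥0∞) :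
    ∀ᵐ x ∂μ, x ∉ czOmega μ F l → F x ≤ l := by
  have := cz_isUnifLocDoubling D
  have := cz_secondCountable D hμ
  filter_upwards [(IsUnifLocDoublingMeasure.vitaliFamily μ 1).ae_tendsto_lintegral_div'
    hF hF'] with x hx hxO
  have h1 := hx.comp (IsUnifLocDoublingMeasure.tendsto_closedBall_filterAt μ (K := 1)
    (l := 𝓝[>] (0 : ℝ)) (fun _ => x) id tendsto_id (by
      filter_upwards [self_mem_nhdsWithin] with δ hδ
      exact mem_closedBall_self (by simpa using (show 0 < δ from hδ).le)))
  refine le_of_tendsto h1 ?_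
  filter_upwards [self_mem_nhdsWithin] with δ hδ
  have hδ : 0 < δ := hδ
  simp only [Function.comp, id]
  apply ENNReal.div_le_of_le_mul
  by_contra hcon
  exact hxO ⟨x, δ, mem_ball_self hδ, not_le.1 hcon⟩

lemma cz_partition {ι : Type*} [Countable ι] (B C : ι → Set X) (hB : ∀ i, MeasurableSet (B i))
    (hC : ∀ i, MeasurableSet (C i)) (hBC : ∀ i, B i ⊆ C i)
    (hd : Pairwise (Function.onFun Disjoint B)) :
    ∃ Q : ι → Set X, (∀ i, MeasurableSet (Q i)) ∧ (∀ i, B i ⊆ Q i) ∧ (∀ i, Q i ⊆ C i) ∧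
      Pairwise (Function.onFun Disjoint Q) ∧ ⋃ i, Q i = ⋃ i, C i := by
  obtain ⟨e, he⟩ := exists_injective_nat ι
  refine ⟨fun i => B i ∪ (C i \ ((⋃ j, B j) ∪ ⋃ j, ⋃ (_ : e j < e i), C j)), ?_, ?_, ?_, ?_, ?_⟩
  · intro i
    exact (hB i).union ((hC i).diff ((MeasurableSet.iUnion hB).union
      (MeasurableSet.iUnion fun j => MeasurableSet.iUnion fun _ => hC j)))
  · intro i; exact subset_union_left
  · intro i; exact union_subset (hBC i) sdiff_subset
  · have hlt : ∀ i j, e i < e j → Disjoint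
        (B i ∪ (C i \ ((⋃ j, B j) ∪ ⋃ k, ⋃ (_ : e k < e i), C k)))
        (B j ∪ (C j \ ((⋃ j, B j) ∪ ⋃ k, ⋃ (_ : e k < e j), C k))) := by
      intro i j hij
      rw [Set.disjoint_left]
      rintro x (hx | hx) (hy | hy)
      · exact Set.disjoint_left.1 (hd (fun h => by simp [h] at hij)) hx hy
      · exact hy.2 (Or.inl (mem_iUnion.2 ⟨i, hx⟩))
      · exact hx.2 (Or.inl (mem_iUnion.2 ⟨j, hy⟩))
      · exact hy.2 (Or.inr (mem_iUnion.2 ⟨i, mem_iUnion.2 ⟨hij, hx.1⟩⟩))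
    intro i j hij
    rcases lt_or_gt_of_ne (fun h => hij (he h)) with h | h
    · exact hlt i j h
    · exact (hlt j i h).symm
  · apply subset_antisymm
    · exact iUnion_mono fun i => union_subset (hBC i) sdiff_subset
    · intro x hx
      by_cases hxB : x ∈ ⋃ j, B j
      · obtain ⟨j, hj⟩ := mem_iUnion.1 hxB
        exact mem_iUnion.2 ⟨j, Or.inl hj⟩
      have hex : ∃ n, ∃ i, e i = n ∧ x ∈ C i := by
        obtain ⟨i, hi⟩ := mem_iUnion.1 hx
        exact ⟨e i, i, rfl, hi⟩
      classical
      obtain ⟨i, hi, hxi⟩ := Nat.find_spec hex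
      refine mem_iUnion.2 ⟨i, Or.inr ⟨hxi, ?_⟩⟩
      rintro (h | h)
      · exact hxB h
      · obtain ⟨j, hj⟩ := mem_iUnion.1 h
        obtain ⟨hj, hxj⟩ := mem_iUnion.1 hj
        exact Nat.find_min hex (hi ▸ hj) ⟨j, rfl, hxj⟩

end CZHelpers

section CZDecomp

open Set Filter Topology

variable {X : Type*} [MetricSpace X] [MeasurableSpace X] [BorelSpace X]
  {μ : Measure X} {a : ℕ}

lemma cz_whitney [IsLocallyFiniteMeasure μ] (D : CZDoubling μ a) (hμ : μ ≠ 0)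
    {O : Set X} (hO : IsOpen O) (hOc : Oᶜ.Nonempty) :
    ∃ (u : Set X) (s : u → ℝ) (Q : u → Set X), u.Countable ∧ (∀ i, 0 < s i) ∧
      (∀ i, MeasurableSet (Q i)) ∧ Pairwise (Function.onFun Disjoint Q) ∧ ⋃ i, Q i = O ∧
      (∀ i, ball i.1 (s i) ⊆ Q i) ∧ (∀ i, Q i ⊆ ball i.1 (3 * s i)) ∧
      (∀ i, ∀ x ∉ O, 8 * s i ≤ dist x i.1) ∧ (∀ i, ∃ x ∉ O, dist x i.1 < 16 * s i) := by
  let d : X → ℝ := fun x => infDist x Oᶜ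
  have hd : ∀ x ∈ O, 0 < d x := by
    intro x hx
    exact (hO.isClosed_compl.notMem_iff_infDist_pos hOc).1 (by simpa using hx)
  obtain ⟨u, huO, hu, hc⟩ := Vitali.exists_disjoint_subfamily_covering_enlargement
    (fun x => ball x (d x / 8)) O (fun _ => (1 : ℝ)) 2 (by norm_num) (fun _ _ => zero_le_one) 1
    (fun _ _ => le_rfl) (fun x hx => ⟨x, mem_ball_self (by have := hd x hx; positivity)⟩)
  have huc : u.Countable := cz_countable D hμ u id _ (fun x => d x / 8)
    (fun x hx => by have := hd x (huO hx); positivity) (fun i _ => subset_rfl) hu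
  have := huc.to_subtype
  obtain ⟨Q, hQm, hBQ, hQC, hQd, hQU⟩ := cz_partition (fun i : u => ball i.1 (d i.1 / 8))
    (fun i : u => ball i.1 (3 * (d i.1 / 8))) (fun _ => measurableSet_ball)
    (fun _ => measurableSet_ball) (fun i => ball_subset_ball (by
      have := hd i.1 (huO i.2); linarith)) (fun i j hij => by
        exact hu i.2 j.2 (fun h => hij (Subtype.ext h)))
  have hfar : ∀ i : u, ∀ x ∉ O, 8 * (d i.1 / 8) ≤ dist x i.1 := by
    intro i x hx
    have : d i.1 ≤ dist i.1 x := infDist_le_dist_of_mem hx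
    rw [dist_comm] at this
    linarith
  refine ⟨u, fun i => d i.1 / 8, Q, huc, fun i => by have := hd i.1 (huO i.2); positivity,
    hQm, hQd, ?_, hBQ, hQC, hfar, ?_⟩
  · rw [hQU]
    apply subset_antisymm
    · refine iUnion_subset fun i x hx => ?_
      by_contra hxO
      have h1 := hfar i x hxO
      have h2 := hd i.1 (huO i.2)
      rw [mem_ball] at hx
      linarith
    · intro x hx
      obtain ⟨b, hb, ⟨z, hz1, hz2⟩, -⟩ := hc x hx
      refine mem_iUnion.2 ⟨⟨b, hb⟩, ?_⟩
      rw [mem_ball] at hz1 hz2 ⊢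
      have h1 : dist x b ≤ dist z x + dist z b := dist_triangle_left x b z
      have h2 : d x ≤ d b + dist x b := infDist_le_infDist_add_dist
      have h3 := hd b (huO hb)
      simp only
      linarith
  · intro i
    have h2 := hd i.1 (huO i.2)
    obtain ⟨y, hy, hy'⟩ := (infDist_lt_iff (x := i.1) (r := 16 * (d i.1 / 8)) hOc).1 (by
      change d i.1 < _
      linarith)
    exact ⟨y, hy, by rwa [dist_comm]⟩

lemma cz_decomp [IsLocallyFiniteMeasure μ] (D : CZDoubling μ a) (hμ : μ ≠ 0)
    {f : X → ℂ} (hf : Measurable f) (hfb : ∃ C, ∀ x, ‖f x‖ ≤ C)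
    (hfi : Integrable f μ) {l : ℝ≥0∞} (hl' : l ≠ ⊤)
    {O : Set X} (hOdef : O = czOmega μ (fun x => ‖f x‖ₑ) l) (hOc : Oᶜ.Nonempty) :
    ∃ (u : Set X) (s : u → ℝ) (Q : u → Set X) (g : X → ℂ), u.Countable ∧ (∀ i, 0 < s i) ∧
      (∀ i, MeasurableSet (Q i)) ∧ Pairwise (Function.onFun Disjoint Q) ∧ ⋃ i, Q i = O ∧
      (∀ i, Q i ⊆ ball i.1 (3 * s i)) ∧
      (∀ i, ∀ x ∉ O, 8 * s i ≤ dist x i.1) ∧ Measurable g ∧ (∃ C, ∀ x, ‖g x‖ ≤ C) ∧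
      (∀ᵐ x ∂μ, ‖g x‖ₑ ≤ 2 ^ (5 * a) * l) ∧ (∀ x ∉ O, g x = f x) ∧
      (∀ i, ∫ x in Q i, g x ∂μ = ∫ x in Q i, f x ∂μ) ∧
      (∀ i, ∫⁻ x in Q i, ‖g x‖ₑ ∂μ ≤ ∫⁻ x in Q i, ‖f x‖ₑ ∂μ) := by
  have hO : IsOpen O := hOdef ▸ cz_omega_isOpen _ _
  obtain ⟨u, s, Q, huc, hs, hQm, hQd, hQU, hBQ, hQC, hfar, hnear⟩ := cz_whitney D hμ hO hOc
  have := huc.to_subtype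
  let c : u → ℂ := fun i => ⨍ x in Q i, f x ∂μ
  have hQfin : ∀ i, μ (Q i) ≠ ⊤ := fun i =>
    ((measure_mono (hQC i)).trans_lt (cz_ball_fin D _ _)).ne
  have hBpos : ∀ i : u, 0 < μ (ball i.1 (s i)) := fun i => cz_ball_pos D hμ _ (hs i)
  have hQpos : ∀ i, μ (Q i) ≠ 0 := fun i => ((hBpos i).trans_le (measure_mono (hBQ i))).ne'
  have hcle : ∀ i, ‖c i‖ₑ * μ (Q i) ≤ ∫⁻ x in Q i, ‖f x‖ₑ ∂μ := by
    intro i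
    have h1 : μ.real (Q i) • c i = ∫ x in Q i, f x ∂μ :=
      measure_smul_setAverage f (hQfin i)
    have h2 : ‖c i‖ₑ * μ (Q i) = ‖∫ x in Q i, f x ∂μ‖ₑ := by
      rw [← h1, enorm_smul, mul_comm, Real.enorm_eq_ofReal measureReal_nonneg,
        ofReal_measureReal (hQfin i)]
    rw [h2]
    exact enorm_integral_le_lintegral_enorm _
  have hcl : ∀ i, ‖c i‖ₑ ≤ 2 ^ (5 * a) * l := by
    intro i
    obtain ⟨p, hp, hp'⟩ := hnear i
    have h1 : ∫⁻ z in closedBall i.1 (16 * s i), ‖f z‖ₑ ∂μ ≤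
        l * μ (closedBall i.1 (16 * s i)) := by
      by_contra hcon
      rw [hOdef] at hp
      exact hp ⟨i.1, 16 * s i, hp', not_le.1 hcon⟩
    have h2 : μ (closedBall i.1 (16 * s i)) ≤ 2 ^ (5 * a) * μ (ball i.1 (s i)) := by
      refine le_trans (measure_mono (closedBall_subset_ball ?_)) (cz_ball_pow D i.1 (hs i) 5)
      have := hs i
      linarith
    have h3 : ‖c i‖ₑ * μ (ball i.1 (s i)) ≤ (2 ^ (5 * a) * l) * μ (ball i.1 (s i)) := by
      calc ‖c i‖ₑ * μ (ball i.1 (s i)) ≤ ‖c i‖ₑ * μ (Q i) := by gcongr; exact hBQ i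
        _ ≤ _ := hcle i
        _ ≤ ∫⁻ z in closedBall i.1 (16 * s i), ‖f z‖ₑ ∂μ := by
            apply lintegral_mono_set
            refine (hQC i).trans (ball_subset_closedBall.trans (closedBall_subset_closedBall ?_))
            have := hs i
            linarith
        _ ≤ _ := h1
        _ ≤ l * (2 ^ (5 * a) * μ (ball i.1 (s i))) := by gcongr
        _ = _ := by ring
    exact (ENNReal.mul_le_mul_iff_left (hBpos i).ne' (cz_ball_fin D _ _).ne).1 h3
  obtain ⟨g, hg, hgeq⟩ := exists_measurable_piecewise (ι := Option u)
    (fun o => o.elim Oᶜ Q) (fun o => by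
      cases o with
      | none => exact hO.measurableSet.compl
      | some i => exact hQm i)
    (fun o => o.elim f (fun i _ => c i)) (fun o => by
      cases o with
      | none => exact hf
      | some i => exact measurable_const) (by
      have hno : ∀ i, ∀ x ∈ Q i, x ∉ Oᶜ := by
        intro i x hx hx'
        exact hx' (hQU ▸ mem_iUnion.2 ⟨i, hx⟩)
      intro o o' hoo x hx
      cases o with
      | none =>
        cases o' with
        | none => exact absurd rfl hoo
        | some j => exact absurd hx.1 (hno j x hx.2)
      | some i =>
        cases o' with
        | none => exact absurd hx.2 (hno i x hx.1)
        | some j =>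
          exact absurd hx.2 (Set.disjoint_left.1 (hQd (fun h => hoo (by rw [h]))) hx.1))
  have hgO : ∀ x ∉ O, g x = f x := fun x hx => hgeq none hx
  have hgQ : ∀ i, ∀ x ∈ Q i, g x = c i := fun i x hx => hgeq (some i) hx
  have hgl : ∀ x ∈ O, ‖g x‖ₑ ≤ 2 ^ (5 * a) * l := by
    intro x hx
    rw [← hQU] at hx
    obtain ⟨i, hi⟩ := mem_iUnion.1 hx
    rw [hgQ i x hi]
    exact hcl i
  refine ⟨u, s, Q, g, huc, hs, hQm, hQd, hQU, hQC, hfar, hg, ?_, ?_, hgO, ?_, ?_⟩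
  · obtain ⟨C, hC⟩ := hfb
    refine ⟨max C (2 ^ (5 * a) * l).toReal, fun x => ?_⟩
    by_cases hx : x ∈ O
    · refine le_max_of_le_right ?_
      rw [← toReal_enorm]
      exact ENNReal.toReal_mono (ENNReal.mul_ne_top (by simp) hl') (hgl x hx)
    · rw [hgO x hx]
      exact le_max_of_le_left (hC x)
  · filter_upwards [cz_ae_le D hμ hf.enorm hfi.2.ne l] with x hx
    by_cases hxO : x ∈ O
    · exact hgl x hxO
    · rw [hgO x hxO]
      refine (hx (hOdef ▸ hxO)).trans ?_
      exact le_mul_of_one_le_left' (one_le_pow₀ (by norm_num))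
  · intro i
    rw [setIntegral_congr_fun (hQm i) (fun x hx => hgQ i x hx), setIntegral_const]
    exact measure_smul_setAverage f (hQfin i)
  · intro i
    rw [setLIntegral_congr_fun (hQm i) (fun x hx => by rw [hgQ i x hx]), setLIntegral_const]
    exact hcle i

end CZDecomp

section CZKernel

set_option linter.unusedSectionVars false

open Set Filter Topology

variable {X : Type*} [MetricSpace X] [MeasurableSpace X] [BorelSpace X]
  {μ : Measure X} {a : ℕ}

lemma cz_inv_le (D : CZDoubling μ a) {x z : X} {R : ℝ} (hR : 0 < R) (h : dist x z < 2 * R) :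
    (μ (ball x R))⁻¹ ≤ 2 ^ (2 * a) * (μ (ball z (2 * R)))⁻¹ := by
  have h1 : μ (ball z (2 * R)) ≤ 2 ^ (2 * a) * μ (ball x R) := by
    refine le_trans (measure_mono (ball_subset_ball' ?_)) (cz_ball_pow D x hR 2)
    rw [dist_comm]
    linarith
  have h2 : (2 ^ (2 * a) * μ (ball x R))⁻¹ ≤ (μ (ball z (2 * R)))⁻¹ := ENNReal.inv_le_inv.2 h1
  have h3 : ((2 : ℝ≥0∞) ^ (2 * a)) ≠ 0 := by simp
  have h4 : ((2 : ℝ≥0∞) ^ (2 * a)) ≠ ⊤ := by simp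
  rw [ENNReal.mul_inv (Or.inl h3) (Or.inl h4)] at h2
  calc (μ (ball x R))⁻¹ = 2 ^ (2 * a) * ((2 ^ (2 * a))⁻¹ * (μ (ball x R))⁻¹) := by
        rw [← mul_assoc, ENNReal.mul_inv_cancel h3 h4, one_mul]
    _ ≤ _ := by gcongr

lemma cz_int1 (D : CZDoubling μ a) (z : X) {R : ℝ} (hR : 0 < R) (S : Set X)
    (hS : MeasurableSet S) (hSR : S ⊆ ball z (2 * R)) :
    ∫⁻ x in S, (μ (ball x R))⁻¹ ∂μ ≤ 2 ^ (2 * a) := by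
  calc ∫⁻ x in S, (μ (ball x R))⁻¹ ∂μ
      ≤ ∫⁻ x in S, 2 ^ (2 * a) * (μ (ball z (2 * R)))⁻¹ ∂μ :=
        setLIntegral_mono' hS (fun x hx => cz_inv_le D hR (mem_ball.1 (hSR hx)))
    _ = 2 ^ (2 * a) * (μ (ball z (2 * R)))⁻¹ * μ S := setLIntegral_const _ _
    _ ≤ 2 ^ (2 * a) * (μ (ball z (2 * R)))⁻¹ * μ (ball z (2 * R)) := by gcongr
    _ = 2 ^ (2 * a) * ((μ (ball z (2 * R)))⁻¹ * μ (ball z (2 * R))) := by rw [mul_assoc]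
    _ ≤ 2 ^ (2 * a) * 1 := by gcongr; exact ENNReal.inv_mul_le_one _
    _ = _ := mul_one _

lemma cz_geom (ha : 4 ≤ a) :
    ∑' k : ℕ, ENNReal.ofReal ((1 / 2 : ℝ) ^ (1 / (a : ℝ))) ^ (k + 1) ≤ 2 ^ a := by
  set q : ℝ := (1 / 2 : ℝ) ^ (1 / (a : ℝ)) with hq
  have ha' : (4 : ℝ) ≤ a := by exact_mod_cast ha
  have hq0 : 0 ≤ q := by positivity
  have h1 : q ≤ 1 - 1 / (2 * a) := by
    have hb : (1 : ℝ) / 2 ≤ (1 - 1 / (2 * a)) ^ a := by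
      have := one_add_mul_le_pow (a := -(1 / (2 * (a : ℝ)))) (by
        have : 1 / (2 * (a : ℝ)) ≤ 1 := by
          rw [div_le_one (by positivity)]; linarith
        linarith) a
      have e : 1 + (a : ℝ) * -(1 / (2 * (a : ℝ))) = 1 / 2 := by field_simp; norm_num
      rw [e] at this
      simpa [sub_eq_add_neg] using this
    have h0 : 0 ≤ 1 - 1 / (2 * (a : ℝ)) := by
      have : 1 / (2 * (a : ℝ)) ≤ 1 := by
        rw [div_le_one (by positivity)]; linarith
      linarith
    calc q ≤ ((1 - 1 / (2 * (a : ℝ))) ^ a) ^ (1 / (a : ℝ)) :=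
          Real.rpow_le_rpow (by norm_num) hb (by positivity)
      _ = _ := by
        rw [one_div (a : ℝ)]
        rw [Real.pow_rpow_inv_natCast h0 (by omega)]
  have h2 : 1 / (2 ^ a : ℝ) ≤ 1 / (2 * a) := by
    apply one_div_le_one_div_of_le (by positivity)
    have : ∀ n : ℕ, 4 ≤ n → 2 * n ≤ 2 ^ n := by
      intro n hn
      induction n, hn using Nat.le_induction with
      | base => norm_num
      | succ n hn ih => rw [pow_succ]; omega
    exact_mod_cast this a ha
  have h3 : ENNReal.ofReal q + (2 ^ a)⁻¹ ≤ 1 := by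
    have e : ((2 : ℝ≥0∞) ^ a)⁻¹ = ENNReal.ofReal (1 / 2 ^ a) := by
      rw [one_div, ENNReal.ofReal_inv_of_pos (by positivity), ENNReal.ofReal_pow (by norm_num)]
      simp
    rw [e, ← ENNReal.ofReal_add hq0 (by positivity), ← ENNReal.ofReal_one]
    apply ENNReal.ofReal_le_ofReal
    linarith
  have hq1 : ENNReal.ofReal q ≤ 1 := le_trans le_self_add h3
  calc ∑' k : ℕ, ENNReal.ofReal q ^ (k + 1) ≤ ∑' k : ℕ, ENNReal.ofReal q ^ k :=
        ENNReal.tsum_le_tsum fun k => pow_le_pow_right_of_le_one' hq1 (Nat.le_succ k)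
    _ = (1 - ENNReal.ofReal q)⁻¹ := ENNReal.tsum_geometric _
    _ ≤ ((2 ^ a)⁻¹)⁻¹ := by
        apply ENNReal.inv_le_inv.2
        exact ENNReal.le_sub_of_add_le_left (by simp) h3
    _ = _ := inv_inv _

lemma cz_int2 (D : CZDoubling μ a) (ha : 4 ≤ a) (z : X) {s : ℝ} (hs : 0 < s) :
    ∫⁻ x in {x | 8 * s ≤ dist x z},
      ENNReal.ofReal ((3 * s / dist x z) ^ (1 / (a : ℝ))) * (μ (ball x (dist x z)))⁻¹ ∂μ
      ≤ 2 ^ (3 * a) := by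
  let A : ℕ → Set X := fun k => {x | 8 * s * 2 ^ k ≤ dist x z ∧ dist x z < 2 * (8 * s * 2 ^ k)}
  have hAm : ∀ k, MeasurableSet (A k) := fun k =>
    ((isClosed_le continuous_const (continuous_id.dist continuous_const)).measurableSet).inter
      ((isOpen_lt (continuous_id.dist continuous_const) continuous_const).measurableSet)
  have hsub : {x | 8 * s ≤ dist x z} ⊆ ⋃ k, A k := by
    intro x hx
    have hx : 8 * s ≤ dist x z := hx
    obtain ⟨n, hn, hn'⟩ := exists_nat_pow_near (x := dist x z / (8 * s)) (y := 2)
      (by rw [one_le_div (by positivity)]; exact hx) (by norm_num)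
    rw [le_div_iff₀ (by positivity)] at hn
    rw [div_lt_iff₀ (by positivity)] at hn'
    refine mem_iUnion.2 ⟨n, ?_, ?_⟩
    · linarith
    · rw [pow_succ] at hn'; linarith
  set q : ℝ≥0∞ := ENNReal.ofReal ((1 / 2 : ℝ) ^ (1 / (a : ℝ))) with hq
  have key : ∀ k, ∫⁻ x in A k,
      ENNReal.ofReal ((3 * s / dist x z) ^ (1 / (a : ℝ))) * (μ (ball x (dist x z)))⁻¹ ∂μ
      ≤ q ^ (k + 1) * 2 ^ (2 * a) := by
    intro k
    calc _ ≤ ∫⁻ x in A k, q ^ (k + 1) * (μ (ball x (8 * s * 2 ^ k)))⁻¹ ∂μ := by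
          refine setLIntegral_mono' (hAm k) (fun x hx => ?_)
          have hd : 0 < dist x z := lt_of_lt_of_le (by positivity) hx.1
          gcongr
          · rw [hq, ← ENNReal.ofReal_pow (by positivity)]
            apply ENNReal.ofReal_le_ofReal
            have e : ((1 / 2 : ℝ) ^ (1 / (a : ℝ))) ^ (k + 1) =
                ((1 / 2 : ℝ) ^ (k + 1)) ^ (1 / (a : ℝ)) := by
              rw [← Real.rpow_natCast, ← Real.rpow_natCast, ← Real.rpow_mul (by norm_num),
                ← Real.rpow_mul (by norm_num), mul_comm]
            rw [e]
            apply Real.rpow_le_rpow (by positivity) _ (by positivity)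
            rw [div_le_iff₀ hd]
            calc 3 * s ≤ (1 / 2) ^ (k + 1) * (8 * s * 2 ^ k) := by
                  have : ((1 : ℝ) / 2) ^ (k + 1) * (8 * s * 2 ^ k) = 4 * s := by
                    rw [pow_succ, one_div, inv_pow]; field_simp; norm_num
                  rw [this]; linarith
              _ ≤ _ := by gcongr; exact hx.1
          · exact hx.1
      _ = q ^ (k + 1) * ∫⁻ x in A k, (μ (ball x (8 * s * 2 ^ k)))⁻¹ ∂μ :=
          lintegral_const_mul' _ _ (ENNReal.pow_ne_top (by simp [hq]))
      _ ≤ _ := by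
          gcongr
          exact cz_int1 D z (by positivity) _ (hAm k) (fun x hx => mem_ball.2 hx.2)
  calc _ ≤ ∫⁻ x in ⋃ k, A k,
      ENNReal.ofReal ((3 * s / dist x z) ^ (1 / (a : ℝ))) * (μ (ball x (dist x z)))⁻¹ ∂μ :=
        lintegral_mono_set hsub
    _ ≤ _ := lintegral_iUnion_le _ _
    _ ≤ ∑' k, q ^ (k + 1) * 2 ^ (2 * a) := ENNReal.tsum_le_tsum key
    _ = (∑' k, q ^ (k + 1)) * 2 ^ (2 * a) := ENNReal.tsum_mul_right
    _ ≤ 2 ^ a * 2 ^ (2 * a) := by gcongr; exact cz_geom ha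
    _ = _ := by rw [← pow_add]; congr 1; ring

variable {K : X → X → ℂ} {r : ℝ}

lemma cz_K_bound (hK_size : ∀ x y, x ≠ y →
      (‖K x y‖₊ : ℝ≥0∞) ≤ 2 ^ (a ^ 3) / μ (ball x (dist x y))) (hr : 0 < r)
    {x y : X} (h : r ≤ dist x y) : ‖K x y‖ₑ ≤ 2 ^ (a ^ 3) * (μ (ball x r))⁻¹ := by
  refine (hK_size x y (dist_pos.1 (hr.trans_le h))).trans ?_
  rw [div_eq_mul_inv]
  gcongr

lemma cz_integrableOn [IsLocallyFiniteMeasure μ] (D : CZDoubling μ a) (hμ : μ ≠ 0)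
    (hK_meas : Measurable (Function.uncurry K))
    (hK_size : ∀ x y, x ≠ y →
      (‖K x y‖₊ : ℝ≥0∞) ≤ 2 ^ (a ^ 3) / μ (ball x (dist x y))) (hr : 0 < r)
    {h : X → ℂ} (hh : Integrable h μ) (x : X) :
    IntegrableOn (fun y => K x y * h y) {y | r ≤ dist x y} μ := by
  have hS : MeasurableSet {y | r ≤ dist x y} :=
    (isClosed_le continuous_const (continuous_const.dist continuous_id)).measurableSet
  have hKm : Measurable (K x) := hK_meas.comp measurable_prodMk_left
  have hB := (cz_ball_pos D hμ x hr).ne'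
  refine Integrable.bdd_mul (c := (2 ^ (a ^ 3) * (μ (ball x r))⁻¹ : ℝ≥0∞).toReal)
    hh.integrableOn hKm.aestronglyMeasurable ?_
  filter_upwards [ae_restrict_mem hS] with y hy
  rw [← toReal_enorm]
  exact ENNReal.toReal_mono (ENNReal.mul_ne_top (by simp) (by simpa using hB))
    (cz_K_bound hK_size hr hy)

lemma cz_meas [IsLocallyFiniteMeasure μ] (D : CZDoubling μ a) (hμ : μ ≠ 0)
    (hK_meas : Measurable (Function.uncurry K)) {h : X → ℂ} (hh : Measurable h) :
    StronglyMeasurable (czOperator μ K r h) := by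
  have := cz_secondCountable D hμ
  have := cz_sigmaFinite D
  have e : czOperator μ K r h = fun x => ∫ y,
      ({p : X × X | r ≤ dist p.1 p.2}.indicator (fun p => K p.1 p.2 * h p.2)) (x, y) ∂μ := by
    funext x
    have hS : MeasurableSet {y | r ≤ dist x y} :=
      (isClosed_le continuous_const (continuous_const.dist continuous_id)).measurableSet
    rw [czOperator, ← integral_indicator hS]
    rfl
  rw [e]
  apply StronglyMeasurable.integral_prod_right'
  apply Measurable.stronglyMeasurable
  apply Measurable.indicator
  · exact hK_meas.mul (hh.comp measurable_snd)
  · exact measurableSet_le measurable_const (measurable_fst.dist measurable_snd)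

lemma cz_bad_int [IsLocallyFiniteMeasure μ] (D : CZDoubling μ a) (hμ : μ ≠ 0) (ha : 4 ≤ a)
    (hK_meas : Measurable (Function.uncurry K))
    (hK_size : ∀ x y, x ≠ y →
      (‖K x y‖₊ : ℝ≥0∞) ≤ 2 ^ (a ^ 3) / μ (ball x (dist x y)))
    (hK_smooth_y : ∀ x y y', x ≠ y → 2 * dist y y' ≤ dist x y →
      (‖K x y - K x y'‖₊ : ℝ≥0∞) ≤
        ENNReal.ofReal ((dist y y' / dist x y) ^ (1 / (a : ℝ))) *
          (2 ^ (a ^ 3) / μ (ball x (dist x y)))) (hr : 0 < r)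
    {h : X → ℂ} (hh : Integrable h μ) (z : X) {s : ℝ} (hs : 0 < s)
    (hsupp : ∀ y, y ∉ ball z (3 * s) → h y = 0) (hmeanz : ∫ y, h y ∂μ = 0) :
    ∫⁻ x in {x | 8 * s ≤ dist x z}, ‖czOperator μ K r h x‖ₑ ∂μ ≤
      2 ^ (a ^ 3) * (2 ^ (3 * a) + 2 ^ (2 * a)) * ∫⁻ y, ‖h y‖ₑ ∂μ := by
  set H := ∫⁻ y, ‖h y‖ₑ ∂μ with hH
  have hHfin : H ≠ ⊤ := hh.2.ne
  have hcont : Continuous fun x : X => dist x z := continuous_id.dist continuous_const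
  let S1 : Set X := {x | 8 * s ≤ dist x z ∧ r + 3 * s ≤ dist x z}
  let S2 : Set X := {x | 8 * s ≤ dist x z ∧ dist x z < r + 3 * s}
  have hS0 : MeasurableSet {x | 8 * s ≤ dist x z} :=
    (isClosed_le continuous_const hcont).measurableSet
  have hS1 : MeasurableSet S1 :=
    hS0.inter (isClosed_le continuous_const hcont).measurableSet
  have hS2 : MeasurableSet S2 :=
    hS0.inter (isOpen_lt hcont continuous_const).measurableSet
  have hsub : {x | 8 * s ≤ dist x z} ⊆ S1 ∪ S2 := by
    intro x hx
    rcases le_or_gt (r + 3 * s) (dist x z) with h | h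
    · exact Or.inl ⟨hx, h⟩
    · exact Or.inr ⟨hx, h⟩
  have b2 : ∫⁻ x in S2, ‖czOperator μ K r h x‖ₑ ∂μ ≤ 2 ^ (a ^ 3) * H * 2 ^ (2 * a) := by
    calc _ ≤ ∫⁻ x in S2, 2 ^ (a ^ 3) * H * (μ (ball x r))⁻¹ ∂μ := by
          refine setLIntegral_mono' hS2 (fun x hx => ?_)
          have hS : MeasurableSet {y | r ≤ dist x y} :=
            (isClosed_le continuous_const (continuous_const.dist continuous_id)).measurableSet
          have hB := (cz_ball_pos D hμ x hr).ne'
          calc ‖czOperator μ K r h x‖ₑ ≤ ∫⁻ y in {y | r ≤ dist x y}, ‖K x y * h y‖ₑ ∂μ :=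
                enorm_integral_le_lintegral_enorm _
            _ ≤ ∫⁻ y in {y | r ≤ dist x y}, 2 ^ (a ^ 3) * (μ (ball x r))⁻¹ * ‖h y‖ₑ ∂μ := by
                refine setLIntegral_mono' hS (fun y hy => ?_)
                rw [enorm_mul]
                gcongr
                exact cz_K_bound hK_size hr hy
            _ ≤ ∫⁻ y, 2 ^ (a ^ 3) * (μ (ball x r))⁻¹ * ‖h y‖ₑ ∂μ :=
                setLIntegral_le_lintegral _ _
            _ = 2 ^ (a ^ 3) * (μ (ball x r))⁻¹ * H := by
                rw [lintegral_const_mul' _ _ (ENNReal.mul_ne_top (by simp) (by simpa using hB))]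
            _ = _ := by ring
      _ = 2 ^ (a ^ 3) * H * ∫⁻ x in S2, (μ (ball x r))⁻¹ ∂μ :=
          lintegral_const_mul' _ _ (ENNReal.mul_ne_top (by simp) hHfin)
      _ ≤ _ := by
          gcongr
          refine cz_int1 D z hr S2 hS2 (fun x hx => mem_ball.2 ?_)
          obtain ⟨h1, h2⟩ := hx
          linarith
  have b1 : ∫⁻ x in S1, ‖czOperator μ K r h x‖ₑ ∂μ ≤ 2 ^ (a ^ 3) * H * 2 ^ (3 * a) := by
    calc _ ≤ ∫⁻ x in S1, 2 ^ (a ^ 3) * H *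
          (ENNReal.ofReal ((3 * s / dist x z) ^ (1 / (a : ℝ))) *
            (μ (ball x (dist x z)))⁻¹) ∂μ := by
          refine setLIntegral_mono' hS1 (fun x hx => ?_)
          obtain ⟨hx1, hx2⟩ := hx
          have hd : 0 < dist x z := lt_of_lt_of_le (by positivity) hx1
          have hB := (cz_ball_pos D hμ x hd).ne'
          have hout : ∀ y, y ∉ {y | r ≤ dist x y} → K x y * h y = 0 := by
            intro y hy
            rw [hsupp y, mul_zero]
            intro hyb
            apply hy
            rw [mem_ball] at hyb
            have := dist_triangle x y z
            change r ≤ dist x y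
            linarith
          have hKi : Integrable (fun y => K x y * h y) μ := by
            rw [← integrableOn_iff_integrable_of_support_subset (s := {y | r ≤ dist x y})]
            · exact cz_integrableOn D hμ hK_meas hK_size hr hh x
            · intro y hy
              by_contra hy'
              exact hy (hout y hy')
          have e : czOperator μ K r h x = ∫ y, (K x y - K x z) * h y ∂μ := by
            rw [czOperator, setIntegral_eq_integral_of_forall_compl_eq_zero hout]
            simp_rw [sub_mul]
            rw [integral_sub hKi (hh.const_mul _), integral_const_mul, hmeanz]
            simp
          set c : ℝ≥0∞ := ENNReal.ofReal ((3 * s / dist x z) ^ (1 / (a : ℝ))) *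
            (μ (ball x (dist x z)))⁻¹ with hc
          have hcfin : c ≠ ⊤ := ENNReal.mul_ne_top (by simp) (by simpa using hB)
          calc ‖czOperator μ K r h x‖ₑ ≤ ∫⁻ y, ‖(K x y - K x z) * h y‖ₑ ∂μ := by
                rw [e]; exact enorm_integral_le_lintegral_enorm _
            _ ≤ ∫⁻ y, 2 ^ (a ^ 3) * c * ‖h y‖ₑ ∂μ := by
                refine lintegral_mono (fun y => ?_)
                by_cases hy : y ∈ ball z (3 * s)
                · rw [enorm_mul]
                  gcongr
                  rw [mem_ball, dist_comm] at hy
                  have h1 := hK_smooth_y x z y (dist_pos.1 hd) (by linarith)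
                  rw [← enorm_neg, neg_sub]
                  refine h1.trans ?_
                  calc _ ≤ ENNReal.ofReal ((3 * s / dist x z) ^ (1 / (a : ℝ))) *
                        (2 ^ a ^ 3 / μ (ball x (dist x z))) := by gcongr
                    _ = _ := by rw [hc, ENNReal.div_eq_inv_mul]; ring
                · simp [hsupp y hy]
            _ = 2 ^ (a ^ 3) * c * H :=
                lintegral_const_mul' _ _ (ENNReal.mul_ne_top (by simp) hcfin)
            _ = _ := by ring
      _ = 2 ^ (a ^ 3) * H * ∫⁻ x in S1, ENNReal.ofReal ((3 * s / dist x z) ^ (1 / (a : ℝ))) *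
            (μ (ball x (dist x z)))⁻¹ ∂μ :=
          lintegral_const_mul' _ _ (ENNReal.mul_ne_top (by simp) hHfin)
      _ ≤ _ := by
          gcongr
          exact (lintegral_mono_set (fun x hx => hx.1)).trans (cz_int2 D ha z hs)
  calc _ ≤ ∫⁻ x in S1 ∪ S2, ‖czOperator μ K r h x‖ₑ ∂μ := lintegral_mono_set hsub
    _ ≤ _ := lintegral_union_le _ _ _
    _ ≤ _ := add_le_add b1 b2
    _ = _ := by ring

end CZKernel

section CZFinal

open Set Filter Topology

variable {X : Type*} [MetricSpace X] [MeasurableSpace X] [BorelSpace X]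
  {μ : Measure X} {a : ℕ} {K : X → X → ℂ} {r : ℝ}

lemma cz_arith (A P N : ℝ≥0∞) (hA : A ≠ 0) (hA' : A ≠ ⊤) (hP : P ≠ 0) (hP' : P ≠ ⊤)
    (ha : 4 ≤ a) {x y z : ℝ≥0∞}
    (hx : x ≤ ((A / 2)⁻¹) ^ 2 * (P ^ 2 * (2 ^ (5 * a) * (A / P) * N)))
    (hy : y ≤ 2 ^ (3 * a) / (A / P) * N)
    (hz : z ≤ (P * (2 ^ (3 * a) + 2 ^ (2 * a)) * (2 * N)) / (A / 2)) :
    x + y + z ≤ P * 2 ^ (21 * a) / A * N := by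
  have e2 : (A / 2)⁻¹ = 2 * A⁻¹ := by
    rw [ENNReal.inv_div (by simp) (by simp), div_eq_mul_inv]
  have eP : (A / P)⁻¹ = P * A⁻¹ := by
    rw [ENNReal.inv_div (Or.inl hP') (Or.inl hP), div_eq_mul_inv]
  have cA : A⁻¹ * A = 1 := ENNReal.inv_mul_cancel hA hA'
  have cP : P * P⁻¹ = 1 := ENNReal.mul_inv_cancel hP hP'
  have hx' : x ≤ P * A⁻¹ * N * (4 * 2 ^ (5 * a)) := by
    refine hx.trans (le_of_eq ?_)
    rw [e2, div_eq_mul_inv]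
    calc (2 * A⁻¹) ^ 2 * (P ^ 2 * (2 ^ (5 * a) * (A * P⁻¹) * N))
        = (A⁻¹ * A) * (P * P⁻¹) * (P * A⁻¹ * N * (2 ^ 2 * 2 ^ (5 * a))) := by ring
      _ = _ := by rw [cA, cP]; norm_num
  have hy' : y ≤ P * A⁻¹ * N * 2 ^ (3 * a) := by
    refine hy.trans (le_of_eq ?_)
    rw [div_eq_mul_inv (2 ^ (3 * a)), eP]; ring
  have hz' : z ≤ P * A⁻¹ * N * (4 * (2 ^ (3 * a) + 2 ^ (2 * a))) := by
    refine hz.trans (le_of_eq ?_)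
    rw [div_eq_mul_inv _ (A / 2), e2]; ring
  have h3 : (2 : ℝ≥0∞) ^ (3 * a) ≤ 2 ^ (5 * a) := pow_le_pow_right₀ (by norm_num) (by omega)
  have h2 : (2 : ℝ≥0∞) ^ (2 * a) ≤ 2 ^ (5 * a) := pow_le_pow_right₀ (by norm_num) (by omega)
  calc x + y + z ≤ P * A⁻¹ * N * (4 * 2 ^ (5 * a)) + P * A⁻¹ * N * 2 ^ (5 * a) +
        P * A⁻¹ * N * (4 * (2 ^ (5 * a) + 2 ^ (5 * a))) := by
        refine add_le_add (add_le_add hx' (hy'.trans ?_)) (hz'.trans ?_)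
        · gcongr
        · gcongr
    _ = P * A⁻¹ * N * (13 * 2 ^ (5 * a)) := by ring
    _ ≤ P * A⁻¹ * N * (2 ^ 4 * 2 ^ (5 * a)) := by gcongr; norm_num
    _ ≤ P * A⁻¹ * N * 2 ^ (21 * a) := by
        gcongr
        rw [← pow_add]
        exact pow_le_pow_right₀ (by norm_num) (by omega)
    _ = _ := by rw [div_eq_mul_inv]; ring

lemma cz_good [IsLocallyFiniteMeasure μ] (D : CZDoubling μ a) (hμ : μ ≠ 0)
    (hK_meas : Measurable (Function.uncurry K))
    (hT : ∀ g : X → ℂ, Measurable g → (∃ C, ∀ x, ‖g x‖ ≤ C) →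
      μ (Function.support g) < ⊤ →
      eLpNorm (czOperator μ K r g) 2 μ ≤ 2 ^ (a ^ 3) * eLpNorm g 2 μ)
    {g : X → ℂ} (hg : Measurable g) (hgb : ∃ C, ∀ x, ‖g x‖ ≤ C)
    (hgs : μ (Function.support g) < ⊤) {G : ℝ≥0∞} (hgG : ∀ᵐ x ∂μ, ‖g x‖ₑ ≤ G)
    {N : ℝ≥0∞} (hgN : ∫⁻ x, ‖g x‖ₑ ∂μ ≤ N) {E : ℝ≥0∞} (hE : E ≠ 0) (hE' : E ≠ ⊤) :
    μ {x | E ≤ ‖czOperator μ K r g x‖ₑ} ≤ (E⁻¹) ^ 2 * ((2 ^ (a ^ 3)) ^ 2 * (G * N)) := by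
  have h1 := meas_ge_le_mul_pow_eLpNorm_enorm (p := 2) (by norm_num) (by norm_num)
    (cz_meas (r := r) D hμ hK_meas hg).aestronglyMeasurable (μ := μ) hE (fun h => absurd h hE')
  have h2 : eLpNorm g 2 μ ^ 2 ≤ G * N := by
    have := eLpNorm_nnreal_pow_eq_lintegral (μ := μ) (f := g) (p := 2) (by norm_num)
    norm_num at this
    rw [this]
    calc ∫⁻ x, ‖g x‖ₑ ^ 2 ∂μ ≤ ∫⁻ x, G * ‖g x‖ₑ ∂μ := by
          apply lintegral_mono_ae
          filter_upwards [hgG] with x hx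
          rw [sq]
          gcongr
      _ = G * ∫⁻ x, ‖g x‖ₑ ∂μ := lintegral_const_mul _ hg.enorm
      _ ≤ _ := by gcongr
  refine h1.trans ?_
  simp only [ENNReal.toReal_ofNat, ENNReal.rpow_ofNat]
  gcongr
  calc _ ≤ (2 ^ (a ^ 3) * eLpNorm g 2 μ) ^ 2 := by gcongr; exact hT g hg hgb hgs
    _ = (2 ^ (a ^ 3)) ^ 2 * eLpNorm g 2 μ ^ 2 := mul_pow _ _ _
    _ ≤ _ := by gcongr

lemma cz_bad [IsLocallyFiniteMeasure μ] (D : CZDoubling μ a) (hμ : μ ≠ 0) (ha : 4 ≤ a)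
    (hK_meas : Measurable (Function.uncurry K))
    (hK_size : ∀ x y, x ≠ y →
      (‖K x y‖₊ : ℝ≥0∞) ≤ 2 ^ (a ^ 3) / μ (ball x (dist x y)))
    (hK_smooth_y : ∀ x y y', x ≠ y → 2 * dist y y' ≤ dist x y →
      (‖K x y - K x y'‖₊ : ℝ≥0∞) ≤
        ENNReal.ofReal ((dist y y' / dist x y) ^ (1 / (a : ℝ))) *
          (2 ^ (a ^ 3) / μ (ball x (dist x y)))) (hr : 0 < r)
    {b : X → ℂ} (hb : Measurable b) (hbi : Integrable b μ) {O : Set X}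
    {u : Set X} (huc : u.Countable) {s : u → ℝ} (hs : ∀ i, 0 < s i) {Q : u → Set X}
    (hQm : ∀ i, MeasurableSet (Q i)) (hQd : Pairwise (Function.onFun Disjoint Q))
    (hQU : ⋃ i, Q i = O) (hQC : ∀ i, Q i ⊆ ball i.1 (3 * s i))
    (hfar : ∀ i, ∀ x ∉ O, 8 * s i ≤ dist x i.1)
    (hbO : ∀ x ∉ O, b x = 0) (hbQ : ∀ i, ∫ x in Q i, b x ∂μ = 0)
    {E : ℝ≥0∞} (hE : E ≠ 0) (hE' : E ≠ ⊤) :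
    μ ({x | E ≤ ‖czOperator μ K r b x‖ₑ} ∩ Oᶜ) ≤
      (2 ^ (a ^ 3) * (2 ^ (3 * a) + 2 ^ (2 * a)) * ∫⁻ x in O, ‖b x‖ₑ ∂μ) / E := by
  have := huc.to_subtype
  have hOm : MeasurableSet O := hQU ▸ MeasurableSet.iUnion hQm
  let h : u → X → ℂ := fun i => (Q i).indicator b
  have hTsum : ∀ x, ‖czOperator μ K r b x‖ₑ ≤ ∑' i, ‖czOperator μ K r (h i) x‖ₑ := by
    intro x
    have hS : IntegrableOn (fun y => K x y * b y) (⋃ i, Q i) (μ.restrict {y | r ≤ dist x y}) :=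
      (cz_integrableOn D hμ hK_meas hK_size hr hbi x).integrableOn
    have h1 := hasSum_integral_iUnion hQm hQd hS
    have h2 : czOperator μ K r b x =
        ∫ y in ⋃ i, Q i, K x y * b y ∂(μ.restrict {y | r ≤ dist x y}) := by
      rw [czOperator]
      refine (setIntegral_eq_integral_of_forall_compl_eq_zero (μ := μ.restrict {y | r ≤ dist x y}) (s := ⋃ i, Q i) ?_).symm
      intro y hy
      rw [hbO y (hQU ▸ hy), mul_zero]
    have h3 : ∀ i, czOperator μ K r (h i) x =
        ∫ y in Q i, K x y * b y ∂(μ.restrict {y | r ≤ dist x y}) := by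
      intro i
      rw [czOperator, ← integral_indicator (hQm i)]
      congr 1
      funext y
      simp only [h, indicator]
      split_ifs <;> simp
    rw [h2, ← h1.tsum_eq]
    simp_rw [h3]
    exact enorm_tsum_le_tsum_enorm
  have hm : ∀ i, Measurable fun x => ‖czOperator μ K r (h i) x‖ₑ := fun i =>
    (cz_meas D hμ hK_meas (hb.indicator (hQm i))).measurable.enorm
  calc μ ({x | E ≤ ‖czOperator μ K r b x‖ₑ} ∩ Oᶜ)
      = (μ.restrict Oᶜ) {x | E ≤ ‖czOperator μ K r b x‖ₑ} :=
        (Measure.restrict_apply' hOm.compl).symm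
    _ ≤ (μ.restrict Oᶜ) {x | E ≤ ∑' i, ‖czOperator μ K r (h i) x‖ₑ} :=
        measure_mono fun x hx => le_trans hx (hTsum x)
    _ ≤ (∫⁻ x in Oᶜ, ∑' i, ‖czOperator μ K r (h i) x‖ₑ ∂μ) / E :=
        meas_ge_le_lintegral_div (Measurable.ennreal_tsum hm).aemeasurable hE hE'
    _ ≤ _ := by
      gcongr
      rw [lintegral_tsum fun i => (hm i).aemeasurable]
      calc ∑' i, ∫⁻ x in Oᶜ, ‖czOperator μ K r (h i) x‖ₑ ∂μ
          ≤ ∑' i, 2 ^ (a ^ 3) * (2 ^ (3 * a) + 2 ^ (2 * a)) * ∫⁻ x in Q i, ‖b x‖ₑ ∂μ := by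
            refine ENNReal.tsum_le_tsum fun i => ?_
            have e : ∫⁻ x, ‖h i x‖ₑ ∂μ = ∫⁻ x in Q i, ‖b x‖ₑ ∂μ := by
              rw [← lintegral_indicator (hQm i)]
              congr 1
              funext y
              simp only [h, indicator]
              split_ifs <;> simp
            rw [← e]
            refine (lintegral_mono_set (fun x hx => hfar i x hx)).trans ?_
            refine cz_bad_int D hμ ha hK_meas hK_size hK_smooth_y hr
              (hbi.indicator (hQm i)) i.1 (hs i) ?_ ?_
            · intro y hy
              exact indicator_of_notMem (fun hy' => hy (hQC i hy')) _
            · rw [integral_indicator (hQm i)]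
              exact hbQ i
        _ = _ := by
          rw [ENNReal.tsum_mul_left, ← hQU, lintegral_iUnion hQm hQd]

end CZFinal

/-- **Calderón–Zygmund weak (1,1) bound**: in a doubling metric measure space `(X, ρ, μ, a)`
with `a ≥ 4` and a two-sided Calderón–Zygmund kernel `K`, if `T_r` is bounded on `L²` with
constant `2^{a³}`, then `μ({x : |T_r f(x)| > α}) ≤ (2^{a³+21a}/α) ∫ |f| dμ` for all bounded
measurable `f` supported on a set of finite measure and all `α > 0`. -/
theorem czoperator_weak_1_1
    {X : Type*} [MetricSpace X] [CompleteSpace X] [LocallyCompactSpace X]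
    [MeasurableSpace X] [BorelSpace X]
    (μ : Measure X) [IsLocallyFiniteMeasure μ] (hμ : μ ≠ 0)
    {a : ℕ} (ha : 4 ≤ a)
    (doubling : ∀ (x : X) (R : ℝ), 0 < R → μ (ball x (2 * R)) ≤ 2 ^ a * μ (ball x R))
    {K : X → X → ℂ} (hK_meas : Measurable (Function.uncurry K))
    (hK_size : ∀ x y, x ≠ y →
      (‖K x y‖₊ : ℝ≥0∞) ≤ 2 ^ (a ^ 3) / μ (ball x (dist x y)))
    (hK_smooth_y : ∀ x y y', x ≠ y → 2 * dist y y' ≤ dist x y →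
      (‖K x y - K x y'‖₊ : ℝ≥0∞) ≤
        ENNReal.ofReal ((dist y y' / dist x y) ^ (1 / (a : ℝ))) *
          (2 ^ (a ^ 3) / μ (ball x (dist x y))))
    (hK_smooth_x : ∀ x x' y, x ≠ y → 2 * dist x x' ≤ dist x y →
      (‖K x y - K x' y‖₊ : ℝ≥0∞) ≤
        ENNReal.ofReal ((dist x x' / dist x y) ^ (1 / (a : ℝ))) *
          (2 ^ (a ^ 3) / μ (ball x (dist x y))))
    {r : ℝ} (hr : 0 < r)
    (hT : ∀ g : X → ℂ, Measurable g → (∃ C, ∀ x, ‖g x‖ ≤ C) →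
      μ (Function.support g) < ⊤ →
      eLpNorm (czOperator μ K r g) 2 μ ≤ 2 ^ (a ^ 3) * eLpNorm g 2 μ)
    {f : X → ℂ} (hf_meas : Measurable f) (hf_bdd : ∃ C, ∀ x, ‖f x‖ ≤ C)
    (hf_supp : μ (Function.support f) < ⊤)
    {α : ℝ} (hα : 0 < α) :
    μ {x | α < ‖czOperator μ K r f x‖} ≤
      2 ^ (a ^ 3 + 21 * a) / ENNReal.ofReal α * ∫⁻ y, (‖f y‖₊ : ℝ≥0∞) ∂μ := by
  have D : CZDoubling μ a := doubling
  have hfi : Integrable f μ := by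
    obtain ⟨C, hC⟩ := hf_bdd
    rw [← integrableOn_iff_integrable_of_support_subset (subset_refl (Function.support f))]
    exact Measure.integrableOn_of_bounded (M := C) hf_supp.ne hf_meas.aestronglyMeasurable
      (Filter.Eventually.of_forall hC)
  change _ ≤ 2 ^ (a ^ 3 + 21 * a) / ENNReal.ofReal α * ∫⁻ y, ‖f y‖ₑ ∂μ
  set A := ENNReal.ofReal α with hA
  set N := ∫⁻ y, ‖f y‖ₑ ∂μ with hN
  set P : ℝ≥0∞ := 2 ^ (a ^ 3) with hP
  have hA0 : A ≠ 0 := by simpa [hA] using hα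
  have hAt : A ≠ ⊤ := by simp [hA]
  have hP0 : P ≠ 0 := by simp [hP]
  have hPt : P ≠ ⊤ := by simp [hP]
  have hl0 : A / P ≠ 0 := ENNReal.div_ne_zero.2 ⟨hA0, hPt⟩
  have hlt : A / P ≠ ⊤ := ENNReal.div_ne_top hAt hP0
  have hE0 : A / 2 ≠ 0 := ENNReal.div_ne_zero.2 ⟨hA0, by simp⟩
  have hEt : A / 2 ≠ ⊤ := ENNReal.div_ne_top hAt (by simp)
  set O := czOmega μ (fun x => ‖f x‖ₑ) (A / P) with hO
  have hOmeas : μ O ≤ 2 ^ (3 * a) / (A / P) * N := cz_omega_measure D hμ _ hl0 hlt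
  rw [pow_add]
  rcases Set.eq_empty_or_nonempty Oᶜ with hOe | hOc
  · have h0 : O = Set.univ := by simpa using hOe
    refine le_trans (measure_mono (Set.subset_univ _)) ?_
    rw [← h0]
    have := cz_arith (a := a) A P N hA0 hAt hP0 hPt ha (x := 0) (z := 0) zero_le hOmeas
      zero_le
    simpa using this
  obtain ⟨u, s, Q, g, huc, hs, hQm, hQd, hQU, hQC, hfar, hg, hgb, hgl, hgO, hgint, hgle⟩ :=
    cz_decomp D hμ hf_meas hf_bdd hfi hlt hO hOc
  have := huc.to_subtype
  have hOm : MeasurableSet O := (cz_omega_isOpen _ _).measurableSet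
  have hgOle : ∫⁻ x in O, ‖g x‖ₑ ∂μ ≤ ∫⁻ x in O, ‖f x‖ₑ ∂μ := by
    rw [← hQU, lintegral_iUnion hQm hQd, lintegral_iUnion hQm hQd]
    exact ENNReal.tsum_le_tsum hgle
  have hgN : ∫⁻ x, ‖g x‖ₑ ∂μ ≤ N := by
    rw [hN, ← lintegral_add_compl _ hOm, ← lintegral_add_compl (fun x => ‖f x‖ₑ) hOm]
    refine add_le_add hgOle (le_of_eq ?_)
    exact setLIntegral_congr_fun hOm.compl (fun x hx => by simp only [hgO x hx])
  have hNt : N ≠ ⊤ := hfi.2.ne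
  have hOfin : μ O < ⊤ := hOmeas.trans_lt (ENNReal.mul_lt_top
    (ENNReal.div_lt_top (by simp) hl0) (lt_top_iff_ne_top.2 hNt))
  have hgs : μ (Function.support g) < ⊤ := by
    refine lt_of_le_of_lt (measure_mono (t := O ∪ Function.support f) ?_)
      ((measure_union_le _ _).trans_lt (ENNReal.add_lt_top.2 ⟨hOfin, hf_supp⟩))
    intro x hx
    by_cases hxO : x ∈ O
    · exact Or.inl hxO
    · right
      rw [Function.mem_support, ← hgO x hxO]
      exact hx
  have hgi : Integrable g μ :=
    ⟨hg.aestronglyMeasurable, hgN.trans_lt (lt_top_iff_ne_top.2 hNt)⟩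
  have good := cz_good (r := r) D hμ hK_meas hT hg hgb hgs hgl hgN hE0 hEt
  have bad := cz_bad (r := r) (b := fun x => f x - g x) D hμ ha hK_meas hK_size hK_smooth_y hr
    (hf_meas.sub hg) (hfi.sub hgi) huc hs hQm hQd hQU hQC hfar
    (fun x hx => by simp [hgO x hx])
    (fun i => by rw [integral_sub hfi.integrableOn hgi.integrableOn, hgint i, sub_self])
    hE0 hEt
  have hbN : ∫⁻ x in O, ‖f x - g x‖ₑ ∂μ ≤ 2 * N := by
    calc ∫⁻ x in O, ‖f x - g x‖ₑ ∂μ ≤ ∫⁻ x in O, (‖f x‖ₑ + ‖g x‖ₑ) ∂μ :=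
          lintegral_mono fun x => enorm_sub_le
      _ = ∫⁻ x in O, ‖f x‖ₑ ∂μ + ∫⁻ x in O, ‖g x‖ₑ ∂μ := lintegral_add_left hf_meas.enorm _
      _ ≤ N + N := add_le_add (setLIntegral_le_lintegral _ _)
          ((setLIntegral_le_lintegral _ _).trans hgN)
      _ = _ := (two_mul N).symm
  have bad' := bad.trans (ENNReal.div_le_div_right (mul_le_mul_right hbN _) _)
  refine le_trans ?_ (cz_arith A P N hA0 hAt hP0 hPt ha good hOmeas bad')
  refine le_trans (measure_mono ?_) ((measure_union_le _ _).trans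
    (add_le_add (measure_union_le _ _) le_rfl))
  intro x hx
  have hx : α < ‖czOperator μ K r f x‖ := hx
  by_cases hxO : x ∈ O
  · exact Or.inl (Or.inr hxO)
  have hlin : czOperator μ K r f x =
      czOperator μ K r g x + czOperator μ K r (fun x => f x - g x) x := by
    have i1 := cz_integrableOn D hμ hK_meas hK_size hr hgi x
    have i2 := cz_integrableOn D hμ hK_meas hK_size hr (hfi.sub hgi) x
    have := integral_add i1 i2
    unfold czOperator
    refine Eq.trans ?_ this
    congr 1
    funext y
    simp only [Pi.sub_apply]
    ring
  by_cases hxg : A / 2 ≤ ‖czOperator μ K r g x‖ₑ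
  · exact Or.inl (Or.inl hxg)
  refine Or.inr ⟨?_, hxO⟩
  by_contra hxb
  have hxb : ‖czOperator μ K r (fun x => f x - g x) x‖ₑ < A / 2 := not_le.1 hxb
  have h1 : A < ‖czOperator μ K r f x‖ₑ := by
    rw [hA, ← ofReal_norm_eq_enorm]
    exact (ENNReal.ofReal_lt_ofReal_iff (hα.trans hx)).2 hx
  have h2 : ‖czOperator μ K r f x‖ₑ < A := by
    rw [hlin]
    calc _ ≤ _ := enorm_add_le _ _
      _ < A / 2 + A / 2 := ENNReal.add_lt_add (not_le.1 hxg) hxb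
      _ = A := ENNReal.add_halves A
  exact absurd h1 (not_lt.2 h2.le)
end

section
/- Let a ≥ 4 be an integer, (X,ρ,μ,a) a doubling metric measure space, and K a two-sided Calderón–Zygmund kernel on it. Assume ‖T_r g‖_{L²(μ)} ≤ 2^{a³} ‖g‖_{L²(μ)} for every bounded measurable g supported on a set of finite measure (for the given r). Then for all 0 < r ≤ R, every x ∈ X, and every bounded measurable g supported on a set of finite measure, |T_R g(x)| ≤ 2² M(T_r g)(x) + 2^{a³+22a+3} M g(x), where M denotes the Hardy–Littlewood maximal operator Mw(x) = sup over open balls B containing x of (1/μ(B)) ∫_B |w| dμ. -/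
open MeasureTheory Metric
open scoped ENNReal NNReal

/-- The (uncentered) Hardy–Littlewood maximal function:
`M w(x) = sup { μ(B)⁻¹ ∫_B |w| dμ : B an open ball with x ∈ B }`. -/
noncomputable def maximalFunction {X : Type*} [MetricSpace X] [MeasurableSpace X]
    (μ : MeasureTheory.Measure X) (w : X → ℂ) (x : X) : ℝ≥0∞ :=
  ⨆ (z : X) (R : ℝ) (_ : x ∈ ball z R),
    (μ (ball z R))⁻¹ * ∫⁻ y in ball z R, (‖w y‖₊ : ℝ≥0∞) ∂μ

section CotlarAux

open Set Filter Topology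

variable {X : Type*} [MetricSpace X] [MeasurableSpace X] {μ : Measure X} {a : ℕ}

lemma cot_dbl (doubling : ∀ (x : X) (R : ℝ), 0 < R → μ (ball x (2 * R)) ≤ 2 ^ a * μ (ball x R))
    (n : ℕ) (x : X) {t : ℝ} (ht : 0 < t) :
    μ (ball x (2 ^ n * t)) ≤ 2 ^ (n * a) * μ (ball x t) := by
  induction n with
  | zero => simp
  | succ n ih =>
    calc μ (ball x (2 ^ (n + 1) * t)) = μ (ball x (2 * (2 ^ n * t))) := by ring_nf
      _ ≤ 2 ^ a * μ (ball x (2 ^ n * t)) := doubling x _ (by positivity)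
      _ ≤ 2 ^ a * (2 ^ (n * a) * μ (ball x t)) := by gcongr
      _ = _ := by ring

/-- comparison of balls -/
lemma cot_cmp (doubling : ∀ (x : X) (R : ℝ), 0 < R → μ (ball x (2 * R)) ≤ 2 ^ a * μ (ball x R))
    (n : ℕ) {x y : X} {t t' : ℝ} (ht : 0 < t) (h : t' + dist x y ≤ 2 ^ n * t) :
    μ (ball y t') ≤ 2 ^ (n * a) * μ (ball x t) := by
  refine le_trans (measure_mono ?_) (cot_dbl doubling n x ht)
  intro z hz
  rw [mem_ball] at *
  have := dist_triangle z y x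
  rw [dist_comm y x] at this
  linarith

lemma cot_pos (hμ : μ ≠ 0)
    (doubling : ∀ (x : X) (R : ℝ), 0 < R → μ (ball x (2 * R)) ≤ 2 ^ a * μ (ball x R))
    (x : X) {t : ℝ} (ht : 0 < t) : μ (ball x t) ≠ 0 := by
  intro h
  apply hμ
  rw [← Measure.measure_univ_eq_zero]
  have : (univ : Set X) = ⋃ n : ℕ, ball x (2 ^ n * t) := by
    symm
    rw [eq_univ_iff_forall]
    intro y
    rw [mem_iUnion]
    obtain ⟨n, hn⟩ := pow_unbounded_of_one_lt (dist y x / t) (one_lt_two)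
    exact ⟨n, by rw [mem_ball]; rwa [div_lt_iff₀ ht] at hn⟩
  rw [this, measure_iUnion_null_iff]
  intro n
  have := cot_dbl doubling n x ht
  rw [h] at this
  simpa using this

lemma cot_fin [IsLocallyFiniteMeasure μ]
    (doubling : ∀ (x : X) (R : ℝ), 0 < R → μ (ball x (2 * R)) ≤ 2 ^ a * μ (ball x R))
    (x : X) (t : ℝ) : μ (ball x t) ≠ ⊤ := by
  obtain ⟨s, hs, hs2⟩ := μ.finiteAt_nhds x
  obtain ⟨ε, hε, hε2⟩ := Metric.mem_nhds_iff.1 hs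
  have h1 : μ (ball x ε) < ⊤ := lt_of_le_of_lt (measure_mono hε2) hs2
  obtain ⟨n, hn⟩ := pow_unbounded_of_one_lt (t / ε) (one_lt_two)
  rw [div_lt_iff₀ hε] at hn
  have := cot_cmp doubling n (x := x) (y := x) (t' := t) hε (by simpa using hn.le)
  refine ne_top_of_le_ne_top (ENNReal.mul_ne_top ?_ h1.ne) this
  exact ENNReal.pow_ne_top (by simp)

lemma cot_sigmaFinite [IsLocallyFiniteMeasure μ]
    (doubling : ∀ (x : X) (R : ℝ), 0 < R → μ (ball x (2 * R)) ≤ 2 ^ a * μ (ball x R))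
    (x : X) : SigmaFinite μ := by
  refine ⟨⟨⟨fun n : ℕ => ball x n, fun _ => trivial, fun n => (cot_fin doubling x n).lt_top, ?_⟩⟩⟩
  exact iUnion_ball_nat x

lemma cot_secondCountable [BorelSpace X] [IsLocallyFiniteMeasure μ] (hμ : μ ≠ 0)
    (doubling : ∀ (x : X) (R : ℝ), 0 < R → μ (ball x (2 * R)) ≤ 2 ^ a * μ (ball x R))
    (x : X) : SecondCountableTopology X := by
  have := cot_sigmaFinite doubling x
  apply Metric.secondCountable_of_almost_dense_set
  intro ε hε
  obtain ⟨u, -, hu, hu2⟩ := Vitali.exists_disjoint_subfamily_covering_enlargement_closedBall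
    (univ : Set X) id (fun _ => ε / 4) (ε / 4) (by simp) 4 (by norm_num)
  refine ⟨u, ?_, ?_⟩
  · have := Measure.countable_meas_pos_of_disjoint_iUnion (μ := μ) (ι := u)
      (As := fun i => closedBall (i : X) (ε / 4)) (fun i => measurableSet_closedBall)
      (by intro i j hij; exact hu i.2 j.2 (by simpa [Subtype.ext_iff] using hij))
    have h2 : {i : u | 0 < μ (closedBall (i : X) (ε / 4))} = univ := by
      rw [eq_univ_iff_forall]
      intro i
      have := cot_pos hμ doubling (i : X) (t := ε / 4) (by positivity)
      exact lt_of_lt_of_le (pos_iff_ne_zero.2 this) (measure_mono ball_subset_closedBall)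
    rw [h2] at this
    exact countable_coe_iff.1 (countable_univ_iff.1 this)
  · intro y
    obtain ⟨b, hb, hb2⟩ := hu2 y trivial
    have := hb2 (mem_closedBall_self (by positivity))
    rw [mem_closedBall] at this
    exact ⟨b, hb, by simp at this; linarith⟩

lemma cot_unifLoc
    (doubling : ∀ (x : X) (R : ℝ), 0 < R → μ (ball x (2 * R)) ≤ 2 ^ a * μ (ball x R)) :
    IsUnifLocDoublingMeasure μ := by
  refine ⟨⟨2 ^ (2 * a), ?_⟩⟩
  filter_upwards [self_mem_nhdsWithin] with ε hε x
  have hε : 0 < ε := hε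
  calc μ (closedBall x (2 * ε)) ≤ μ (ball x (4 * ε)) :=
        measure_mono (closedBall_subset_ball (by linarith))
    _ ≤ 2 ^ (2 * a) * μ (ball x ε) := cot_cmp doubling 2 hε (by simp; norm_num)
    _ ≤ _ := by
      push_cast
      gcongr
      exact ball_subset_closedBall

/-- inversion helper -/
lemma cot_inv {C P Q : ℝ≥0∞} (h0 : C ≠ 0) (hC : C ≠ ⊤) (h : Q ≤ C * P) : P⁻¹ ≤ C * Q⁻¹ := by
  calc P⁻¹ = C * (C * P)⁻¹ := by
        rw [ENNReal.mul_inv (Or.inl h0) (Or.inl hC), ← mul_assoc, ENNReal.mul_inv_cancel h0 hC,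
          one_mul]
    _ ≤ C * Q⁻¹ := by gcongr

lemma cot_two_a (ha : 4 ≤ a) : (2 * a : ℝ) ≤ 2 ^ a := by
  have : 2 * a ≤ 2 ^ a := by
    induction a, ha using Nat.le_induction with
    | base => norm_num
    | succ n hn ih => rw [pow_succ]; omega
  exact_mod_cast this

/-- geometric sum -/
lemma cot_geom (ha : 4 ≤ a) :
    ∑' n : ℕ, (ENNReal.ofReal (((1 : ℝ) / 2) ^ (1 / (a : ℝ)))) ^ n ≤ 2 ^ a := by
  have ha' : (4 : ℝ) ≤ a := by exact_mod_cast ha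
  have key : ((1 : ℝ) / 2) ^ (1 / (a : ℝ)) ≤ 1 - 1 / (2 * a) := by
    have hb : (0 : ℝ) ≤ 1 - 1 / (2 * a) := by
      rw [sub_nonneg, div_le_one (by positivity)]; linarith
    have h1 : (1 : ℝ) / 2 ≤ (1 - 1 / (2 * a)) ^ a := by
      have := one_add_mul_le_pow (a := -(1 / (2 * (a : ℝ)))) (by linarith) a
      have h3 : 1 + (a : ℝ) * -(1 / (2 * a)) = 1 / 2 := by field_simp; norm_num
      rw [h3] at this
      simpa [sub_eq_add_neg] using this
    calc ((1 : ℝ) / 2) ^ (1 / (a : ℝ)) ≤ ((1 - 1 / (2 * a)) ^ a) ^ (1 / (a : ℝ)) := by gcongr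
      _ = _ := by
        rw [one_div (a : ℝ), Real.pow_rpow_inv_natCast hb (by omega)]
  rw [ENNReal.tsum_geometric]
  have h2 : (1 : ℝ≥0∞) - ENNReal.ofReal (((1 : ℝ) / 2) ^ (1 / (a : ℝ)))
      ≥ ENNReal.ofReal (1 / (2 * a)) := by
    rw [← ENNReal.ofReal_one, ← ENNReal.ofReal_sub _ (by positivity)]
    apply ENNReal.ofReal_le_ofReal
    linarith
  calc _ ≤ (ENNReal.ofReal (1 / (2 * a)))⁻¹ := ENNReal.inv_le_inv.2 h2
    _ = ENNReal.ofReal (2 * a) := by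
      rw [← ENNReal.ofReal_inv_of_pos (by positivity)]; simp
    _ ≤ ENNReal.ofReal (2 ^ a) := ENNReal.ofReal_le_ofReal (cot_two_a ha)
    _ = 2 ^ a := by rw [ENNReal.ofReal_pow (by norm_num)]; simp

/-- dyadic annuli sum -/
lemma cot_dyad [BorelSpace X] [IsLocallyFiniteMeasure μ] (hμ : μ ≠ 0) (ha : 4 ≤ a)
    (doubling : ∀ (x : X) (R : ℝ), 0 < R → μ (ball x (2 * R)) ≤ 2 ^ a * μ (ball x R))
    (y : X) {s : ℝ} (hs : 0 < s) (w : X → ℝ≥0∞) (A : ℝ≥0∞)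
    (hw : ∀ t : ℝ, 0 < t → ∫⁻ z in ball y t, w z ∂μ ≤ A * μ (ball y t)) :
    ∫⁻ z in {z | s ≤ dist z y}, ENNReal.ofReal ((s / dist z y) ^ (1 / (a : ℝ))) *
      (μ (ball y (dist z y)))⁻¹ * w z ∂μ ≤ 2 ^ (2 * a) * A := by
  set θ := ENNReal.ofReal (((1 : ℝ) / 2) ^ (1 / (a : ℝ))) with hθ
  let S : ℕ → Set X := fun n => {z | 2 ^ n * s ≤ dist z y ∧ dist z y < 2 ^ (n + 1) * s}
  have hS : ∀ n, MeasurableSet (S n) := by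
    intro n
    have hd : Measurable (fun z : X => dist z y) := (continuous_id.dist continuous_const).measurable
    exact (measurableSet_le measurable_const hd).inter (measurableSet_lt hd measurable_const)
  have hcov : {z | s ≤ dist z y} ⊆ ⋃ n, S n := by
    intro z hz
    have hz : s ≤ dist z y := hz
    obtain ⟨n, hn1, hn2⟩ := exists_nat_pow_near (x := dist z y / s) (y := (2 : ℝ))
      (by rw [le_div_iff₀ hs]; linarith) one_lt_two
    rw [le_div_iff₀ hs] at hn1
    rw [div_lt_iff₀ hs] at hn2
    exact mem_iUnion.2 ⟨n, hn1, hn2⟩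
  have hterm : ∀ n, ∫⁻ z in S n, ENNReal.ofReal ((s / dist z y) ^ (1 / (a : ℝ))) *
      (μ (ball y (dist z y)))⁻¹ * w z ∂μ ≤ θ ^ n * (2 ^ a * A) := by
    intro n
    have hb0 := cot_pos hμ doubling y (t := 2 ^ n * s) (by positivity)
    have hbt := cot_fin doubling y (2 ^ n * s)
    calc _ ≤ ∫⁻ z in S n, (θ ^ n * (μ (ball y (2 ^ n * s)))⁻¹) * w z ∂μ := by
          apply setLIntegral_mono' (hS n)
          intro z hz
          have hz1 : 2 ^ n * s ≤ dist z y := hz.1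
          gcongr
          rw [hθ, ← ENNReal.ofReal_pow (by positivity)]
          apply ENNReal.ofReal_le_ofReal
          rw [← Real.rpow_natCast, ← Real.rpow_mul (by norm_num), mul_comm,
            Real.rpow_mul (by norm_num)]
          apply Real.rpow_le_rpow (by positivity) _ (by positivity)
          have hd0 : 0 < dist z y := lt_of_lt_of_le (by positivity) hz1
          rw [Real.rpow_natCast, div_le_iff₀ hd0]
          calc s = (1 / 2) ^ n * (2 ^ n * s) := by
                rw [← mul_assoc, ← mul_pow]; norm_num
            _ ≤ _ := by gcongr
      _ = (θ ^ n * (μ (ball y (2 ^ n * s)))⁻¹) * ∫⁻ z in S n, w z ∂μ := by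
          apply lintegral_const_mul'
          exact ENNReal.mul_ne_top (ENNReal.pow_ne_top ENNReal.ofReal_ne_top)
            (ENNReal.inv_ne_top.2 hb0)
      _ ≤ (θ ^ n * (μ (ball y (2 ^ n * s)))⁻¹) * (A * (2 ^ a * μ (ball y (2 ^ n * s)))) := by
          gcongr
          calc _ ≤ ∫⁻ z in ball y (2 ^ (n + 1) * s), w z ∂μ :=
                lintegral_mono_set (fun z hz => hz.2)
            _ ≤ A * μ (ball y (2 ^ (n + 1) * s)) := hw _ (by positivity)
            _ ≤ _ := by
              gcongr
              rw [pow_succ', mul_assoc]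
              exact doubling y _ (by positivity)
      _ = θ ^ n * (2 ^ a * A) * ((μ (ball y (2 ^ n * s)))⁻¹ * μ (ball y (2 ^ n * s))) := by ring
      _ = _ := by rw [ENNReal.inv_mul_cancel hb0 hbt, mul_one]
  calc _ ≤ ∫⁻ z in ⋃ n, S n, ENNReal.ofReal ((s / dist z y) ^ (1 / (a : ℝ))) *
      (μ (ball y (dist z y)))⁻¹ * w z ∂μ := lintegral_mono_set hcov
    _ ≤ ∑' n, ∫⁻ z in S n, ENNReal.ofReal ((s / dist z y) ^ (1 / (a : ℝ))) *
      (μ (ball y (dist z y)))⁻¹ * w z ∂μ := lintegral_iUnion_le _ _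
    _ ≤ ∑' n, θ ^ n * (2 ^ a * A) := ENNReal.tsum_le_tsum hterm
    _ = (∑' n, θ ^ n) * (2 ^ a * A) := ENNReal.tsum_mul_right
    _ ≤ 2 ^ a * (2 ^ a * A) := by gcongr; exact cot_geom ha
    _ = _ := by ring

end CotlarAux

section CotlarAux

open Set Filter Topology

variable {X : Type*} [MetricSpace X] [MeasurableSpace X] {μ : Measure X} {a : ℕ}

lemma cot_pow {m n : ℕ} (h : m ≤ n) : (2 : ℝ≥0∞) ^ m ≤ 2 ^ n :=
  pow_le_pow_right₀ (by norm_num) h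

/-- truncated kernel -/
noncomputable def cotK (K : X → X → ℂ) (r : ℝ) (z y : X) : ℂ :=
  {y | r ≤ dist z y}.indicator (K z) y

lemma cotK_of_le {K : X → X → ℂ} {r : ℝ} {z y : X} (h : r ≤ dist z y) : cotK K r z y = K z y :=
  indicator_of_mem (s := {y | r ≤ dist z y}) h _

lemma cotK_of_lt {K : X → X → ℂ} {r : ℝ} {z y : X} (h : dist z y < r) : cotK K r z y = 0 :=
  indicator_of_notMem (s := {y | r ≤ dist z y}) (not_le.2 h) _

lemma cot_op_eq [BorelSpace X] (K : X → X → ℂ) (r : ℝ) (f : X → ℂ) (z : X) :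
    czOperator μ K r f z = ∫ y, cotK K r z y * f y ∂μ := by
  unfold czOperator
  have hd : Measurable (fun y : X => dist z y) := (continuous_const.dist continuous_id).measurable
  have hm : MeasurableSet {y : X | r ≤ dist z y} := measurableSet_le measurable_const hd
  rw [← integral_indicator hm]
  congr 1
  ext y
  unfold cotK
  by_cases h : y ∈ {y : X | r ≤ dist z y}
  · rw [indicator_of_mem h, indicator_of_mem h]
  · rw [indicator_of_notMem h, indicator_of_notMem h, zero_mul]

lemma cotK_meas [BorelSpace X] [SecondCountableTopology X] {K : X → X → ℂ}
    (hK : Measurable (Function.uncurry K)) (r : ℝ) : Measurable (Function.uncurry (cotK K r)) := by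
  have : Function.uncurry (cotK K r) =
      {p : X × X | r ≤ dist p.1 p.2}.indicator (Function.uncurry K) := by
    ext ⟨z, y⟩
    simp [cotK, indicator, Function.uncurry]
  rw [this]
  exact hK.indicator (measurableSet_le measurable_const
    (continuous_fst.dist continuous_snd).measurable)

lemma cot_op_meas [BorelSpace X] [SecondCountableTopology X] [SFinite μ] {K : X → X → ℂ}
    (hK : Measurable (Function.uncurry K)) (r : ℝ) {f : X → ℂ} (hf : Measurable f) :
    StronglyMeasurable (czOperator μ K r f) := by
  have : czOperator μ K r f = fun z => ∫ y, cotK K r z y * f y ∂μ := by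
    ext z; exact cot_op_eq K r f z
  rw [this]
  apply StronglyMeasurable.integral_prod_right (f := fun z y => cotK K r z y * f y)
  exact ((cotK_meas hK r).mul (hf.comp measurable_snd)).stronglyMeasurable

lemma cotK_bound {K : X → X → ℂ} (hK_size : ∀ x y, x ≠ y →
      (‖K x y‖₊ : ℝ≥0∞) ≤ 2 ^ (a ^ 3) / μ (ball x (dist x y))) {r : ℝ} (hr : 0 < r) (z y : X) :
    ‖cotK K r z y‖ₑ ≤ 2 ^ (a ^ 3) * (μ (ball z r))⁻¹ := by
  rcases le_or_gt r (dist z y) with h | h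
  · rw [cotK_of_le h]
    refine (hK_size z y (by rw [← dist_pos]; linarith)).trans ?_
    rw [ENNReal.div_eq_inv_mul, mul_comm]
    gcongr
  · rw [cotK_of_lt h]; simp

lemma cot_int [BorelSpace X] [SecondCountableTopology X] [IsLocallyFiniteMeasure μ] (hμ : μ ≠ 0)
    (doubling : ∀ (x : X) (R : ℝ), 0 < R → μ (ball x (2 * R)) ≤ 2 ^ a * μ (ball x R))
    {K : X → X → ℂ} (hK : Measurable (Function.uncurry K)) (hK_size : ∀ x y, x ≠ y →
      (‖K x y‖₊ : ℝ≥0∞) ≤ 2 ^ (a ^ 3) / μ (ball x (dist x y))) {r : ℝ} (hr : 0 < r) (z : X)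
    {f : X → ℂ} (hf : Integrable f μ) : Integrable (fun y => cotK K r z y * f y) μ := by
  have hfin : 2 ^ (a ^ 3) * (μ (ball z r))⁻¹ ≠ ⊤ :=
    ENNReal.mul_ne_top (ENNReal.pow_ne_top (by simp))
      (ENNReal.inv_ne_top.2 (cot_pos hμ doubling z hr))
  refine hf.bdd_mul (c := (2 ^ (a ^ 3) * (μ (ball z r))⁻¹).toReal) ?_ ?_
  · exact ((cotK_meas hK r).comp measurable_prodMk_left).aestronglyMeasurable
  · refine Eventually.of_forall fun y => ?_
    rw [← toReal_enorm]
    exact ENNReal.toReal_mono hfin (cotK_bound hK_size hr z y)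

/-- Hormander majorant -/
noncomputable def cotPhi (μ : Measure X) (a : ℕ) (r s : ℝ) (y z : X) : ℝ≥0∞ :=
  2 ^ (a ^ 3 + a) * (ENNReal.ofReal ((s / dist z y) ^ (1 / (a : ℝ))) * (μ (ball y (dist z y)))⁻¹) +
    (ball y (4 * r)).indicator (fun _ => 2 ^ (a ^ 3 + 3 * a) * (μ (ball y (4 * r)))⁻¹) z

lemma cotPhi_meas [BorelSpace X] (r s : ℝ) (y : X) : Measurable (cotPhi μ a r s y) := by
  have hd : Measurable (fun z : X => dist z y) := (continuous_id.dist continuous_const).measurable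
  have hm : Measurable (fun t : ℝ => μ (ball y t)) :=
    Monotone.measurable (fun t t' h => measure_mono (ball_subset_ball h))
  unfold cotPhi
  refine Measurable.add ?_ (measurable_const.indicator measurableSet_ball)
  refine Measurable.const_mul (Measurable.mul ?_ (hm.comp hd).inv) _
  exact ((measurable_const.div hd).pow_const _).ennreal_ofReal

lemma cotPhi_int [BorelSpace X] [IsLocallyFiniteMeasure μ] (hμ : μ ≠ 0) (ha : 4 ≤ a)
    (doubling : ∀ (x : X) (R : ℝ), 0 < R → μ (ball x (2 * R)) ≤ 2 ^ a * μ (ball x R))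
    {r s : ℝ} (hr : 0 < r) (hs : 0 < s) (y : X) :
    ∫⁻ z in {z | s ≤ dist z y}, cotPhi μ a r s y z ∂μ ≤ 2 ^ (a ^ 3 + 4 * a) := by
  have h1 := cot_dyad hμ ha doubling y hs (fun _ => 1) 1 (fun t ht => by simp)
  simp only [mul_one] at h1
  unfold cotPhi
  rw [lintegral_add_right _ (measurable_const.indicator measurableSet_ball),
    lintegral_const_mul' _ _ (ENNReal.pow_ne_top (by simp))]
  calc _ ≤ 2 ^ (a ^ 3 + a) * 2 ^ (2 * a) + ∫⁻ z, (ball y (4 * r)).indicator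
        (fun _ => 2 ^ (a ^ 3 + 3 * a) * (μ (ball y (4 * r)))⁻¹) z ∂μ := by
        exact add_le_add (mul_le_mul' le_rfl h1) (setLIntegral_le_lintegral _ _)
    _ = 2 ^ (a ^ 3 + 3 * a) + 2 ^ (a ^ 3 + 3 * a) := by
      rw [lintegral_indicator_const measurableSet_ball, mul_assoc, ENNReal.inv_mul_cancel
        (cot_pos hμ doubling y (by positivity)) (cot_fin doubling y _), mul_one]
      ring
    _ = 2 ^ (a ^ 3 + 3 * a + 1) := by ring
    _ ≤ _ := by
      apply pow_le_pow_right₀ (by norm_num)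
      omega

lemma cotPhi_bound
    (doubling : ∀ (x : X) (R : ℝ), 0 < R → μ (ball x (2 * R)) ≤ 2 ^ a * μ (ball x R))
    {K : X → X → ℂ}
    (hK_size : ∀ x y, x ≠ y →
      (‖K x y‖₊ : ℝ≥0∞) ≤ 2 ^ (a ^ 3) / μ (ball x (dist x y)))
    (hK_smooth_y : ∀ x y y', x ≠ y → 2 * dist y y' ≤ dist x y →
      (‖K x y - K x y'‖₊ : ℝ≥0∞) ≤
        ENNReal.ofReal ((dist y y' / dist x y) ^ (1 / (a : ℝ))) *
          (2 ^ (a ^ 3) / μ (ball x (dist x y))))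
    {r s : ℝ} (hr : 0 < r) (hs : 0 < s) {y y' z : X} (hy : dist y y' ≤ s)
    (hz : 2 * s ≤ dist z y) :
    ‖cotK K r z y' - cotK K r z y‖ₑ ≤ cotPhi μ a r s y z := by
  have hd : 0 < dist z y := by linarith
  have t1 := dist_triangle z y y'
  have t2 := dist_triangle z y' y
  rw [dist_comm y' y] at t2
  have mixed : dist z y < 3 * r → ∀ w, ‖cotK K r z w‖ₑ ≤ cotPhi μ a r s y z := by
    intro h w
    refine (cotK_bound hK_size hr z w).trans ?_
    unfold cotPhi
    rw [indicator_of_mem (by rw [mem_ball]; linarith)]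
    refine le_trans ?_ le_add_self
    rw [pow_add, mul_assoc]
    gcongr
    refine cot_inv (pow_ne_zero _ (by simp)) (ENNReal.pow_ne_top (by simp)) ?_
    exact cot_cmp doubling 3 hr (by linarith)
  rcases le_or_gt r (dist z y) with h | h <;> rcases le_or_gt r (dist z y') with h' | h'
  · rw [cotK_of_le h, cotK_of_le h', ← enorm_neg, neg_sub]
    refine (hK_smooth_y z y y' (by rw [← dist_pos]; exact hd) (by linarith)).trans ?_
    unfold cotPhi
    refine le_trans ?_ le_self_add
    rw [ENNReal.div_eq_inv_mul]
    calc _ ≤ ENNReal.ofReal ((s / dist z y) ^ (1 / (a : ℝ))) *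
          ((2 ^ a * (μ (ball y (dist z y)))⁻¹) * 2 ^ a ^ 3) := by
          gcongr
          refine cot_inv (pow_ne_zero _ (by simp)) (ENNReal.pow_ne_top (by simp)) ?_
          simpa using cot_cmp doubling 1 hd (y := y) (t' := dist z y) (by linarith)
      _ = _ := by ring
  · rw [cotK_of_lt h', zero_sub, enorm_neg]
    exact mixed (by linarith) y
  · rw [cotK_of_lt h, sub_zero]
    exact mixed (by linarith) y'
  · rw [cotK_of_lt h, cotK_of_lt h']; simp

/-- comparison of `T_R g (x)` with `T_r (g 1_{B(x,R/2)^c}) (x')`. -/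
lemma cot_compare [BorelSpace X] [SecondCountableTopology X] [IsLocallyFiniteMeasure μ]
    (hμ : μ ≠ 0) (ha : 4 ≤ a)
    (doubling : ∀ (x : X) (R : ℝ), 0 < R → μ (ball x (2 * R)) ≤ 2 ^ a * μ (ball x R))
    {K : X → X → ℂ} (hK : Measurable (Function.uncurry K))
    (hK_size : ∀ x y, x ≠ y →
      (‖K x y‖₊ : ℝ≥0∞) ≤ 2 ^ (a ^ 3) / μ (ball x (dist x y)))
    (hK_smooth_x : ∀ x x' y, x ≠ y → 2 * dist x x' ≤ dist x y →
      (‖K x y - K x' y‖₊ : ℝ≥0∞) ≤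
        ENNReal.ofReal ((dist x x' / dist x y) ^ (1 / (a : ℝ))) *
          (2 ^ (a ^ 3) / μ (ball x (dist x y))))
    {r R : ℝ} (hr : 0 < r) (hrR : r ≤ R) {g : X → ℂ} (hg : Integrable g μ) (hgm : Measurable g)
    {x x' : X} (hx : dist x x' < R / 4) {A : ℝ≥0∞}
    (hA : ∀ t : ℝ, 0 < t → ∫⁻ z in ball x t, ‖g z‖ₑ ∂μ ≤ A * μ (ball x t)) :
    ‖czOperator μ K R g x - czOperator μ K r ((ball x (R / 2))ᶜ.indicator g) x'‖ₑ ≤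
      2 ^ (a ^ 3 + 5 * a) * A := by
  have hR : 0 < R := by linarith
  have hg1 : Integrable ((ball x (R / 2))ᶜ.indicator g) μ :=
    hg.indicator measurableSet_ball.compl
  rw [cot_op_eq, cot_op_eq, ← integral_sub (cot_int hμ doubling hK hK_size hR x hg)
    (cot_int hμ doubling hK hK_size hr x' hg1)]
  refine (enorm_integral_le_lintegral_enorm _).trans ?_
  set F1 : X → ℝ≥0∞ := fun y => {z | R ≤ dist z x}.indicator (fun z => 2 ^ (a ^ 3) *
    (ENNReal.ofReal ((R / dist z x) ^ (1 / (a : ℝ))) * (μ (ball x (dist z x)))⁻¹ * ‖g z‖ₑ)) y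
  set F2 : X → ℝ≥0∞ := fun y => (ball x (2 * R)).indicator (fun z =>
    (2 ^ (a ^ 3 + 4 * a + 1) * (μ (ball x (2 * R)))⁻¹) * ‖g z‖ₑ) y with hF2
  have hF2m : Measurable F2 := by
    refine Measurable.indicator ?_ measurableSet_ball
    exact hgm.enorm.const_mul _
  have hms : MeasurableSet {z | R ≤ dist z x} :=
    measurableSet_le measurable_const (continuous_id.dist continuous_const).measurable
  have pw : ∀ y, ‖cotK K R x y * g y - cotK K r x' y * (ball x (R / 2))ᶜ.indicator g y‖ₑ ≤
      F1 y + F2 y := by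
    intro y
    have t1 := dist_triangle x x' y
    have t2 := dist_triangle x' x y
    rw [dist_comm x' x] at t2
    rcases lt_or_ge (dist x y) (R / 2) with h | h
    · rw [cotK_of_lt (by linarith), indicator_of_notMem]
      · simp
      · rw [mem_compl_iff, not_not, mem_ball, dist_comm]; exact h
    rw [indicator_of_mem (by rw [mem_compl_iff, mem_ball, dist_comm]; linarith), ← sub_mul,
      enorm_mul]
    rcases lt_or_ge (dist x y) (2 * R) with h2 | h2
    · refine le_trans ?_ le_add_self
      rw [hF2]
      simp only
      rw [indicator_of_mem (by rw [mem_ball, dist_comm]; exact h2)]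
      gcongr
      have b1 : ‖cotK K R x y‖ₑ ≤ 2 ^ (a ^ 3 + 4 * a) * (μ (ball x (2 * R)))⁻¹ := by
        refine (cotK_bound hK_size hR x y).trans ?_
        rw [pow_add, mul_assoc]
        gcongr
        refine cot_inv (pow_ne_zero _ (by simp)) (ENNReal.pow_ne_top (by simp)) ?_
        exact cot_cmp doubling 4 hR (by simp; linarith)
      have b2 : ‖cotK K r x' y‖ₑ ≤ 2 ^ (a ^ 3 + 4 * a) * (μ (ball x (2 * R)))⁻¹ := by
        rcases le_or_gt r (dist x' y) with h | h
        · rw [cotK_of_le h]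
          refine (hK_size x' y (by rw [← dist_pos]; linarith)).trans ?_
          rw [ENNReal.div_eq_inv_mul, mul_comm, pow_add, mul_assoc]
          gcongr
          refine cot_inv (pow_ne_zero _ (by simp)) (ENNReal.pow_ne_top (by simp)) ?_
          refine cot_cmp doubling 4 (by linarith) ?_
          rw [dist_comm x' x]
          linarith
        · rw [cotK_of_lt h]; simp
      calc _ ≤ ‖cotK K R x y‖ₑ + ‖cotK K r x' y‖ₑ := enorm_sub_le
        _ ≤ _ := add_le_add b1 b2
        _ = _ := by ring
    · refine le_trans ?_ le_self_add
      simp only [F1]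
      rw [indicator_of_mem (by show R ≤ dist y x; rw [dist_comm]; linarith), ← mul_assoc]
      gcongr
      rw [cotK_of_le (by linarith), cotK_of_le (by linarith)]
      refine (hK_smooth_x x x' y (by rw [← dist_pos]; linarith) (by linarith)).trans ?_
      rw [ENNReal.div_eq_inv_mul, dist_comm y x]
      calc _ ≤ ENNReal.ofReal ((R / dist x y) ^ (1 / (a : ℝ))) *
          ((μ (ball x (dist x y)))⁻¹ * 2 ^ a ^ 3) := by
            gcongr
            linarith
        _ = _ := by ring
  calc _ ≤ ∫⁻ y, F1 y + F2 y ∂μ := lintegral_mono pw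
    _ = ∫⁻ y, F1 y ∂μ + ∫⁻ y, F2 y ∂μ := lintegral_add_right _ hF2m
    _ ≤ 2 ^ (a ^ 3) * (2 ^ (2 * a) * A) + 2 ^ (a ^ 3 + 4 * a + 1) * A := by
      gcongr
      · rw [lintegral_indicator hms, lintegral_const_mul' _ _ (ENNReal.pow_ne_top (by simp))]
        gcongr
        exact cot_dyad hμ ha doubling x hR _ A hA
      · rw [lintegral_indicator measurableSet_ball, lintegral_const_mul _ hgm.enorm]
        calc _ ≤ 2 ^ (a ^ 3 + 4 * a + 1) * (μ (ball x (2 * R)))⁻¹ * (A * μ (ball x (2 * R))) := by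
              gcongr
              exact hA _ (by positivity)
          _ = 2 ^ (a ^ 3 + 4 * a + 1) * A * ((μ (ball x (2 * R)))⁻¹ * μ (ball x (2 * R))) := by ring
          _ = _ := by rw [ENNReal.inv_mul_cancel
            (cot_pos hμ doubling x (by positivity)) (cot_fin doubling x _), mul_one]
    _ = (2 ^ (a ^ 3 + 2 * a) + 2 ^ (a ^ 3 + 4 * a + 1)) * A := by ring
    _ ≤ (2 ^ (a ^ 3 + 4 * a + 1) + 2 ^ (a ^ 3 + 4 * a + 1)) * A := by
      exact mul_le_mul' (add_le_add (cot_pow (by omega)) le_rfl) le_rfl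
    _ = 2 ^ (a ^ 3 + 4 * a + 2) * A := by ring
    _ ≤ _ := mul_le_mul' (cot_pow (by omega)) le_rfl

end CotlarAux

section CotlarAux

open Set Filter Topology

variable {X : Type*} [MetricSpace X] [MeasurableSpace X] {μ : Measure X} {a : ℕ}

/-- selection of stopping balls -/
lemma cot_cover [BorelSpace X] [SecondCountableTopology X] [IsLocallyFiniteMeasure μ]
    (hμ : μ ≠ 0)
    (doubling : ∀ (x : X) (R : ℝ), 0 < R → μ (ball x (2 * R)) ≤ 2 ^ a * μ (ball x R))
    {w : X → ℝ≥0∞} (hw : Measurable w) {x : X} {ρ : ℝ} (hρ : 0 < ρ)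
    (hsupp : ∀ y, y ∉ ball x ρ → w y = 0) {A : ℝ≥0∞} (hAt : A ≠ ⊤)
    (hA : ∫⁻ y, w y ∂μ ≤ A * μ (ball x ρ)) :
    ∃ (u : Set X) (s : X → ℝ), u.Countable ∧ (∀ y ∈ u, 0 < s y) ∧
      (u.PairwiseDisjoint fun y => closedBall y (s y)) ∧
      (∀ y ∈ u, 2 ^ (6 * a) * A * μ (closedBall y (s y)) ≤ ∫⁻ z in closedBall y (s y), w z ∂μ) ∧
      (∀ y ∈ u, ∫⁻ z in closedBall y (5 * s y), w z ∂μ ≤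
        2 ^ (6 * a) * A * μ (closedBall y (5 * s y))) ∧
      ∀ᵐ y ∂μ, y ∉ (⋃ b : u, closedBall (b : X) (5 * s b)) → w y ≤ 2 ^ (6 * a) * A := by
  set L := 2 ^ (6 * a) * A with hL
  let P : X → ℝ → Prop := fun y s => 0 < s ∧
    L * μ (closedBall y s) < ∫⁻ z in closedBall y s, w z ∂μ
  have hbd : ∀ y s, P y s → s < 2 * ρ := by
    rintro y s ⟨hs, hP⟩
    by_contra! hcon
    have hne : (closedBall y s ∩ ball x ρ).Nonempty := by
      by_contra hne
      rw [not_nonempty_iff_eq_empty] at hne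
      have : ∫⁻ z in closedBall y s, w z ∂μ = 0 := by
        rw [setLIntegral_congr_fun (g := fun _ => 0) measurableSet_closedBall]
        · simp
        · intro z hz
          apply hsupp
          intro hz2
          have : z ∈ closedBall y s ∩ ball x ρ := ⟨hz, hz2⟩
          rw [hne] at this
          exact this
      rw [this] at hP
      exact absurd hP not_lt_zero
    obtain ⟨z, hz1, hz2⟩ := hne
    rw [mem_closedBall] at hz1
    rw [mem_ball] at hz2
    have t := dist_triangle_left y x z
    have h1 : μ (ball x ρ) ≤ 2 ^ (2 * a) * μ (ball y s) :=
      cot_cmp doubling 2 hs (by linarith)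
    have h2 : L * μ (closedBall y s) < L * μ (closedBall y s) := by
      calc _ < ∫⁻ z in closedBall y s, w z ∂μ := hP
        _ ≤ ∫⁻ z, w z ∂μ := setLIntegral_le_lintegral _ _
        _ ≤ A * μ (ball x ρ) := hA
        _ ≤ A * (2 ^ (2 * a) * μ (ball y s)) := by gcongr
        _ = 2 ^ (2 * a) * A * μ (ball y s) := by ring
        _ ≤ L * μ (closedBall y s) := by
          refine mul_le_mul' (mul_le_mul' (cot_pow (by omega)) le_rfl)
            (measure_mono ball_subset_closedBall)
    exact lt_irrefl _ h2
  let Ω : Set X := {y | ∃ s, P y s}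
  have hsel : ∀ y, ∃ s, y ∈ Ω → P y s ∧ ∀ t, 2 * s ≤ t → ¬ P y t := by
    intro y
    by_cases hy : y ∈ Ω
    · obtain ⟨s0, hs0⟩ := hy
      have hne : {s | P y s}.Nonempty := ⟨s0, hs0⟩
      have hba : BddAbove {s | P y s} := ⟨2 * ρ, fun s hs => (hbd y s hs).le⟩
      have hpos : 0 < sSup {s | P y s} := lt_of_lt_of_le hs0.1 (le_csSup hba hs0)
      obtain ⟨s, hs, hs2⟩ := exists_lt_of_lt_csSup hne (half_lt_self hpos)
      refine ⟨s, fun _ => ⟨hs, fun t ht hPt => ?_⟩⟩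
      have := le_csSup hba hPt
      linarith
    · exact ⟨0, fun h => absurd h hy⟩
  choose s hs using hsel
  obtain ⟨u, huΩ, hdisj, hcov⟩ := Vitali.exists_disjoint_subfamily_covering_enlargement_closedBall
    Ω id s (2 * ρ) (fun y hy => (hbd y _ (hs y hy).1).le) 5 (by norm_num)
  have hpos : ∀ y ∈ u, 0 < s y := fun y hy => (hs y (huΩ hy)).1.1
  refine ⟨u, s, ?_, hpos, hdisj, fun y hy => (hs y (huΩ hy)).1.2.le, ?_, ?_⟩
  · refine hdisj.countable_of_nonempty_interior fun y hy => ?_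
    exact (nonempty_ball.2 (hpos y hy)).mono ball_subset_interior_closedBall
  · intro y hy
    have h1 := (hs y (huΩ hy)).2 (5 * s y) (by linarith [hpos y hy])
    by_contra! hcon
    exact h1 ⟨by linarith [hpos y hy], hcon⟩
  · have hUL := cot_unifLoc doubling
    have hwfin : ∫⁻ y, w y ∂μ ≠ ⊤ :=
      ne_top_of_le_ne_top (ENNReal.mul_ne_top hAt (cot_fin doubling x ρ)) hA
    filter_upwards [(IsUnifLocDoublingMeasure.vitaliFamily μ 1).ae_tendsto_lintegral_div
      hw.aemeasurable hwfin] with y hy hyU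
    have hyΩ : y ∉ Ω := by
      intro h
      apply hyU
      obtain ⟨b, hb, hb2⟩ := hcov y h
      exact mem_iUnion.2 ⟨⟨b, hb⟩, hb2 (mem_closedBall_self (hs y h).1.1.le)⟩
    have ht := IsUnifLocDoublingMeasure.tendsto_closedBall_filterAt μ (K := 1) (x := y)
      (l := 𝓝[>] (0 : ℝ)) (fun _ => y) id tendsto_id (by
        filter_upwards [self_mem_nhdsWithin] with t ht
        exact mem_closedBall_self (by simpa using (le_of_lt ht)))
    refine le_of_tendsto (hy.comp ht) ?_
    filter_upwards [self_mem_nhdsWithin] with t ht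
    have ht : 0 < t := ht
    apply ENNReal.div_le_of_le_mul
    by_contra! hcon
    exact hyΩ ⟨t, ht, hcon⟩

lemma cot_disj {ι : Type*} [Countable ι] {V : ι → Set X} (hV : ∀ i, MeasurableSet (V i)) :
    ∃ Q : ι → Set X, (∀ i, Q i ⊆ V i) ∧ (∀ i, MeasurableSet (Q i)) ∧
      Pairwise (Function.onFun Disjoint Q) ∧ ⋃ i, Q i = ⋃ i, V i := by
  have := Encodable.ofCountable ι
  refine ⟨fun i => V i \ ⋃ (j : ι) (_ : Encodable.encode j < Encodable.encode i), V j,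
    fun i => sdiff_subset, fun i => ?_, ?_, ?_⟩
  · exact (hV i).diff (MeasurableSet.iUnion fun j => MeasurableSet.iUnion fun _ => hV j)
  · have key : ∀ i j, Encodable.encode i < Encodable.encode j → Disjoint
      (V i \ ⋃ (k : ι) (_ : Encodable.encode k < Encodable.encode i), V k)
      (V j \ ⋃ (k : ι) (_ : Encodable.encode k < Encodable.encode j), V k) := by
      intro i j hij
      rw [Set.disjoint_left]
      intro z hz hz2
      exact hz2.2 (mem_iUnion₂.2 ⟨i, hij, hz.1⟩)
    intro i j hij
    rcases lt_trichotomy (Encodable.encode i) (Encodable.encode j) with h | h | h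
    · exact key i j h
    · exact absurd (Encodable.encode_injective h) hij
    · exact (key j i h).symm
  · apply Subset.antisymm (iUnion_mono fun i => sdiff_subset)
    intro z hz
    classical
    rw [mem_iUnion] at hz
    have hex : ∃ n, ∃ i, Encodable.encode i = n ∧ z ∈ V i := by
      obtain ⟨i, hi⟩ := hz
      exact ⟨_, i, rfl, hi⟩
    obtain ⟨i, hi, hzi⟩ := Nat.find_spec hex
    refine mem_iUnion.2 ⟨i, hzi, ?_⟩
    intro hcon
    obtain ⟨j, hj, hzj⟩ := mem_iUnion₂.1 hcon
    rw [hi] at hj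
    exact Nat.find_min hex hj ⟨j, rfl, hzj⟩

lemma cot_bracket {Q B : Set X} (hQ : MeasurableSet Q) (hB : MeasurableSet B) {f k : X → ℂ}
    {k0 c : ℂ} {φ m : ℝ≥0∞} (hf : Integrable f μ) (hkf : Integrable (fun y => k y * f y) μ)
    (hk : IntegrableOn k B μ) (hkQ : ∀ y ∈ Q, ‖k y - k0‖ₑ ≤ φ) (hkB : ∀ y ∈ B, ‖k y - k0‖ₑ ≤ φ)
    (hμB : μ B ≠ ⊤) (hc : c * ((μ B).toReal : ℂ) = ∫ y in Q, f y ∂μ) (hcm : ‖c‖ₑ * μ B ≤ m)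
    (hm : ∫⁻ y in Q, ‖f y‖ₑ ∂μ ≤ m) :
    ‖∫ y in Q, k y * f y ∂μ - ∫ y in B, k y * c ∂μ‖ₑ ≤ φ * (2 * m) := by
  have hcB : IntegrableOn (fun _ => k0) B μ := integrableOn_const hμB
  have e1 : ∫ y in Q, (k y - k0) * f y ∂μ = ∫ y in Q, k y * f y ∂μ - k0 * ∫ y in Q, f y ∂μ := by
    rw [← integral_const_mul, ← integral_sub hkf.integrableOn (hf.integrableOn.const_mul k0)]
    congr 1
    ext y
    ring
  have e2 : ∫ y in B, (k y - k0) * c ∂μ =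
      ∫ y in B, k y * c ∂μ - k0 * (c * ((μ B).toReal : ℂ)) := by
    have : ∫ y in B, k0 * c ∂μ = k0 * (c * ((μ B).toReal : ℂ)) := by
      rw [setIntegral_const, Measure.real, Complex.real_smul]
      ring
    rw [← this, ← integral_sub (hk.mul_const c) (hcB.mul_const c)]
    congr 1
    ext y
    ring
  have e3 : ∫ y in Q, k y * f y ∂μ - ∫ y in B, k y * c ∂μ =
      ∫ y in Q, (k y - k0) * f y ∂μ - ∫ y in B, (k y - k0) * c ∂μ := by
    rw [e1, e2, hc]; ring
  rw [e3]
  calc _ ≤ ‖∫ y in Q, (k y - k0) * f y ∂μ‖ₑ + ‖∫ y in B, (k y - k0) * c ∂μ‖ₑ := enorm_sub_le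
    _ ≤ φ * m + φ * m := by
      gcongr
      · refine (enorm_integral_le_lintegral_enorm _).trans ?_
        calc _ ≤ ∫⁻ y in Q, φ * ‖f y‖ₑ ∂μ := by
              apply setLIntegral_mono' hQ
              intro y hy
              rw [enorm_mul]
              gcongr
              exact hkQ y hy
          _ = φ * ∫⁻ y in Q, ‖f y‖ₑ ∂μ :=
            lintegral_const_mul'' _ hf.aestronglyMeasurable.restrict.enorm
          _ ≤ _ := by gcongr
      · refine (enorm_integral_le_lintegral_enorm _).trans ?_
        calc _ ≤ ∫⁻ y in B, φ * ‖c‖ₑ ∂μ := by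
              apply setLIntegral_mono' hB
              intro y hy
              rw [enorm_mul]
              gcongr
              exact hkB y hy
          _ = φ * (‖c‖ₑ * μ B) := by rw [setLIntegral_const]; ring
          _ ≤ _ := by gcongr
    _ = _ := by ring

lemma cot_L2 {G H : X → ℂ} {F : Set X} {A b C N : ℝ≥0∞} {n : ℕ}
    (hL : ∀ᵐ y ∂μ, ‖G y‖ₑ ≤ 2 ^ n * A) (hL1 : ∫⁻ y, ‖G y‖ₑ ∂μ ≤ A * b) (hA : A ≠ ⊤)
    (hn : (2 : ℝ≥0∞) ^ n ≤ N ^ 2)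
    (hH : AEStronglyMeasurable H μ) (hGH : eLpNorm H 2 μ ≤ C * eLpNorm G 2 μ) (hF : μ F ≤ b) :
    ∫⁻ y in F, ‖H y‖ₑ ∂μ ≤ C * N * A * b := by
  have h1 : eLpNorm G 2 μ ≤ N * A * b ^ (1 / 2 : ℝ) := by
    rw [eLpNorm_eq_lintegral_rpow_enorm_toReal (by simp) (by simp)]
    simp only [ENNReal.toReal_ofNat]
    calc _ ≤ ((N * A) ^ (2 : ℝ) * b) ^ (1 / 2 : ℝ) := by
          gcongr
          calc _ ≤ ∫⁻ y, (2 ^ n * A) * ‖G y‖ₑ ∂μ := by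
                apply lintegral_mono_ae
                filter_upwards [hL] with y hy
                rw [ENNReal.rpow_ofNat, sq]
                gcongr
            _ = (2 ^ n * A) * ∫⁻ y, ‖G y‖ₑ ∂μ :=
              lintegral_const_mul' _ _ (ENNReal.mul_ne_top (ENNReal.pow_ne_top (by simp)) hA)
            _ ≤ (N ^ 2 * A) * (A * b) := by gcongr
            _ = _ := by rw [ENNReal.rpow_ofNat]; ring
      _ = _ := by
        rw [ENNReal.mul_rpow_of_nonneg _ _ (by norm_num), ← ENNReal.rpow_mul]
        norm_num
  calc ∫⁻ y in F, ‖H y‖ₑ ∂μ = eLpNorm H 1 (μ.restrict F) := eLpNorm_one_eq_lintegral_enorm.symm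
    _ ≤ eLpNorm H 2 (μ.restrict F) * (μ.restrict F) univ ^ (1 / (1 : ℝ≥0∞).toReal -
        1 / (2 : ℝ≥0∞).toReal) :=
      eLpNorm_le_eLpNorm_mul_rpow_measure_univ (by norm_num) hH.restrict
    _ = eLpNorm H 2 (μ.restrict F) * (μ F) ^ (1 / 2 : ℝ) := by
      rw [Measure.restrict_apply_univ]; norm_num
    _ ≤ (C * (N * A * b ^ (1 / 2 : ℝ))) * b ^ (1 / 2 : ℝ) := by
      gcongr
      exact (eLpNorm_mono_measure H Measure.restrict_le_self).trans
        (hGH.trans (by gcongr))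
    _ = C * N * A * (b ^ (1 / 2 : ℝ) * b ^ (1 / 2 : ℝ)) := by ring
    _ = _ := by
      rw [← ENNReal.rpow_add_of_nonneg _ _ (by norm_num) (by norm_num)]
      norm_num

end CotlarAux

section CotlarAux

open Set Filter Topology

variable {X : Type*} [MetricSpace X] [MeasurableSpace X] {μ : Measure X} {a : ℕ}

/-- local weak type estimate via a Calderon-Zygmund decomposition -/
lemma cot_weak [BorelSpace X] [SecondCountableTopology X] [SigmaFinite μ]
    [IsLocallyFiniteMeasure μ]
    (hμ : μ ≠ 0) (ha : 4 ≤ a)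
    (doubling : ∀ (x : X) (R : ℝ), 0 < R → μ (ball x (2 * R)) ≤ 2 ^ a * μ (ball x R))
    {K : X → X → ℂ} (hK : Measurable (Function.uncurry K))
    (hK_size : ∀ x y, x ≠ y →
      (‖K x y‖₊ : ℝ≥0∞) ≤ 2 ^ (a ^ 3) / μ (ball x (dist x y)))
    (hK_smooth_y : ∀ x y y', x ≠ y → 2 * dist y y' ≤ dist x y →
      (‖K x y - K x y'‖₊ : ℝ≥0∞) ≤
        ENNReal.ofReal ((dist y y' / dist x y) ^ (1 / (a : ℝ))) *
          (2 ^ (a ^ 3) / μ (ball x (dist x y))))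
    {r : ℝ} (hr : 0 < r)
    (hT : ∀ g : X → ℂ, Measurable g → (∃ C, ∀ x, ‖g x‖ ≤ C) →
      μ (Function.support g) < ⊤ →
      eLpNorm (czOperator μ K r g) 2 μ ≤ 2 ^ (a ^ 3) * eLpNorm g 2 μ)
    {f : X → ℂ} (hf : Measurable f) (hfb : ∃ C, ∀ x, ‖f x‖ ≤ C) {x : X} {ρ : ℝ} (hρ : 0 < ρ)
    (hsupp : ∀ y, y ∉ ball x ρ → f y = 0) {A : ℝ≥0∞} (hA0 : A ≠ 0) (hAt : A ≠ ⊤)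
    (hA : ∫⁻ y, ‖f y‖ₑ ∂μ ≤ A * μ (ball x ρ)) :
    ∃ E : Set X, MeasurableSet E ∧ 2 ^ (2 * a) * μ E ≤ μ (ball x ρ) ∧
      ∫⁻ z in ball x ρ \ E, ‖czOperator μ K r f z‖ₑ ∂μ ≤
        2 ^ (a ^ 3 + 6 * a) * (A * μ (ball x ρ)) := by
  obtain ⟨u, s, hu, hspos, hdisj, hbig, hsmall, hae⟩ := cot_cover hμ doubling hf.enorm hρ
    (fun y hy => by rw [hsupp y hy]; simp) hAt hA
  set L := 2 ^ (6 * a) * A with hL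
  have hL0 : L ≠ 0 := mul_ne_zero (pow_ne_zero _ (by simp)) hA0
  have hLt : L ≠ ⊤ := ENNReal.mul_ne_top (ENNReal.pow_ne_top (by simp)) hAt
  have hcount : Countable u := hu.to_subtype
  set b := μ (ball x ρ) with hb
  have hbt : b ≠ ⊤ := cot_fin doubling x ρ
  have hAbt : A * b ≠ ⊤ := ENNReal.mul_ne_top hAt hbt
  set V : u → Set X := fun j => closedBall (j : X) (5 * s j) with hV
  set B : u → Set X := fun j => closedBall (j : X) (s j) with hBdef
  have hVm : ∀ j, MeasurableSet (V j) := fun j => measurableSet_closedBall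
  have hBm : ∀ j, MeasurableSet (B j) := fun j => measurableSet_closedBall
  have hBV : ∀ j, B j ⊆ V j := fun j =>
    closedBall_subset_closedBall (by linarith [hspos j j.2])
  obtain ⟨Q, hQV, hQm, hQd, hQU⟩ := cot_disj hVm
  have hBd : Pairwise (Function.onFun Disjoint B) := by
    intro i j hij
    exact hdisj i.2 j.2 (fun h => hij (Subtype.ext h))
  have hBball : ∀ j : u, μ (ball (j : X) (s j)) ≤ μ (B j) := fun j =>
    measure_mono ball_subset_closedBall
  have hB0 : ∀ j, μ (B j) ≠ 0 := fun j h =>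
    cot_pos hμ doubling (j : X) (hspos j j.2) (le_antisymm (h ▸ hBball j) zero_le)
  have hBt : ∀ j, μ (B j) ≠ ⊤ := fun j =>
    ne_top_of_le_ne_top (cot_fin doubling (j : X) (2 * s j))
      (measure_mono (closedBall_subset_ball (by linarith [hspos j j.2])))
  have hfint : Integrable f μ :=
    ⟨hf.aestronglyMeasurable, lt_of_le_of_lt hA hAbt.lt_top⟩
  set m : u → ℝ≥0∞ := fun j => ∫⁻ y in Q j, ‖f y‖ₑ ∂μ with hm
  set c : u → ℂ := fun j => (∫ y in Q j, f y ∂μ) / ((μ (B j)).toReal : ℂ) with hc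
  have hBr : ∀ j, ((μ (B j)).toReal : ℂ) ≠ 0 := fun j => by
    rw [Ne, Complex.ofReal_eq_zero, ENNReal.toReal_eq_zero_iff]
    simp [hB0 j, hBt j]
  have hc1 : ∀ j, c j * ((μ (B j)).toReal : ℂ) = ∫ y in Q j, f y ∂μ := fun j =>
    div_mul_cancel₀ _ (hBr j)
  have hc2 : ∀ j, ‖c j‖ₑ * μ (B j) ≤ m j := by
    intro j
    have h1 : ‖((μ (B j)).toReal : ℂ)‖ₑ = μ (B j) := by
      rw [← ofReal_norm, Complex.norm_real, Real.norm_of_nonneg ENNReal.toReal_nonneg,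
        ENNReal.ofReal_toReal (hBt j)]
    rw [← h1, ← enorm_mul, hc1]
    exact enorm_integral_le_lintegral_enorm _
  have hVB : ∀ j, μ (V j) ≤ 2 ^ (3 * a) * μ (B j) := by
    intro j
    have hp := hspos j j.2
    calc μ (V j) ≤ μ (ball (j : X) (8 * s j)) :=
          measure_mono (closedBall_subset_ball (by linarith))
      _ ≤ 2 ^ (3 * a) * μ (ball (j : X) (s j)) := cot_cmp doubling 3 hp (by simp; norm_num)
      _ ≤ _ := mul_le_mul' le_rfl (hBball j)
  have hc3 : ∀ j, ‖c j‖ₑ ≤ 2 ^ (3 * a) * L := by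
    intro j
    have : ‖c j‖ₑ * μ (B j) ≤ 2 ^ (3 * a) * L * μ (B j) := by
      calc _ ≤ m j := hc2 j
        _ ≤ ∫⁻ y in V j, ‖f y‖ₑ ∂μ := lintegral_mono_set (hQV j)
        _ ≤ L * μ (V j) := hsmall j j.2
        _ ≤ L * (2 ^ (3 * a) * μ (B j)) := by gcongr; exact hVB j
        _ = _ := by ring
    exact (ENNReal.mul_le_mul_iff_left (hB0 j) (hBt j)).1 this
  set U := ⋃ j, V j with hU
  have hUm : MeasurableSet U := MeasurableSet.iUnion hVm
  set W := ⋃ j, B j with hW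
  have hWm : MeasurableSet W := MeasurableSet.iUnion hBm
  have hWU : W ⊆ U := iUnion_mono hBV
  have hmU : ∑' j, m j = ∫⁻ y in U, ‖f y‖ₑ ∂μ := by
    rw [← hQU, lintegral_iUnion hQm hQd]
  have hmA : ∑' j, m j ≤ A * b := by
    rw [hmU]; exact (setLIntegral_le_lintegral _ _).trans hA
  -- the good function
  obtain ⟨G, hGm, hG⟩ := exists_measurable_piecewise (ι := Option u)
    (fun o => o.elim Wᶜ B) (by rintro (_ | j); exacts [hWm.compl, hBm j])
    (fun o => o.elim (Uᶜ.indicator f) (fun j _ => c j))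
    (by rintro (_ | j); exacts [hf.indicator hUm.compl, measurable_const])
    (by
      rintro (_ | i) (_ | j) hij z ⟨hz1, hz2⟩
      · rfl
      · exact absurd (mem_iUnion.2 ⟨j, hz2⟩) hz1
      · exact absurd (mem_iUnion.2 ⟨i, hz1⟩) hz2
      · have hij' : i ≠ j := fun h => hij (by rw [h])
        exact absurd hz2 (Set.disjoint_left.1 (hBd hij') hz1))
  have hGW : ∀ y, y ∉ W → G y = Uᶜ.indicator f y := fun y hy => hG none hy
  have hGB : ∀ j, ∀ y ∈ B j, G y = c j := fun j y hy => hG (some j) hy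
  have hGL : ∀ᵐ y ∂μ, ‖G y‖ₑ ≤ 2 ^ (9 * a) * A := by
    filter_upwards [hae] with y hy
    have e : 2 ^ (3 * a) * L = 2 ^ (9 * a) * A := by rw [hL]; ring
    by_cases hyW : y ∈ W
    · obtain ⟨j, hj⟩ := mem_iUnion.1 hyW
      rw [hGB j y hj, ← e]
      exact hc3 j
    · rw [hGW y hyW]
      by_cases hyU : y ∈ U
      · rw [indicator_of_notMem (by simpa using hyU)]; simp
      · rw [indicator_of_mem hyU]
        exact (hy hyU).trans (mul_le_mul' (cot_pow (by omega)) le_rfl)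
  have hG1 : ∫⁻ y, ‖G y‖ₑ ∂μ ≤ A * b := by
    rw [← lintegral_add_compl _ hWm]
    have h1 : ∫⁻ y in W, ‖G y‖ₑ ∂μ ≤ ∫⁻ y in U, ‖f y‖ₑ ∂μ := by
      rw [hW, lintegral_iUnion hBm hBd, ← hmU]
      apply ENNReal.tsum_le_tsum
      intro j
      refine le_trans (le_of_eq ?_) (hc2 j)
      rw [← setLIntegral_const]
      exact setLIntegral_congr_fun (hBm j) (fun y hy => by simp only [hGB j y hy])
    have h2 : ∫⁻ y in Wᶜ, ‖G y‖ₑ ∂μ ≤ ∫⁻ y in Uᶜ, ‖f y‖ₑ ∂μ := by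
      calc _ = ∫⁻ y in Wᶜ, Uᶜ.indicator (fun y => ‖f y‖ₑ) y ∂μ := by
            refine setLIntegral_congr_fun hWm.compl (fun y hy => ?_)
            simp only [hGW y hy]
            rw [enorm_indicator_eq_indicator_enorm]
        _ ≤ ∫⁻ y, Uᶜ.indicator (fun y => ‖f y‖ₑ) y ∂μ := setLIntegral_le_lintegral _ _
        _ = _ := lintegral_indicator hUm.compl _
    calc _ ≤ ∫⁻ y in U, ‖f y‖ₑ ∂μ + ∫⁻ y in Uᶜ, ‖f y‖ₑ ∂μ := add_le_add h1 h2
      _ = ∫⁻ y, ‖f y‖ₑ ∂μ := lintegral_add_compl _ hUm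
      _ ≤ _ := hA
  have hGint : Integrable G μ := ⟨hGm.aestronglyMeasurable, lt_of_le_of_lt hG1 hAbt.lt_top⟩
  have hLB : L * ∑' j, μ (B j) ≤ A * b := by
    rw [← ENNReal.tsum_mul_left]
    calc _ ≤ ∑' j, ∫⁻ y in B j, ‖f y‖ₑ ∂μ := ENNReal.tsum_le_tsum fun j => hbig j j.2
      _ = ∫⁻ y in W, ‖f y‖ₑ ∂μ := by rw [hW, lintegral_iUnion hBm hBd]
      _ ≤ _ := (setLIntegral_le_lintegral _ _).trans hA
  have hGbdd : ∃ C, ∀ y, ‖G y‖ ≤ C := by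
    obtain ⟨C, hC⟩ := hfb
    refine ⟨max C (2 ^ (3 * a) * L).toReal, fun y => ?_⟩
    by_cases hyW : y ∈ W
    · obtain ⟨j, hj⟩ := mem_iUnion.1 hyW
      rw [hGB j y hj, ← toReal_enorm]
      exact le_max_of_le_right (ENNReal.toReal_mono
        (ENNReal.mul_ne_top (ENNReal.pow_ne_top (by simp)) hLt) (hc3 j))
    · rw [hGW y hyW]
      exact le_max_of_le_left ((norm_indicator_le_norm_self f y).trans (hC y))
  have hGs : μ (Function.support G) < ⊤ := by
    have hWt : μ W ≠ ⊤ := by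
      intro h
      have h1 : L * μ W ≤ A * b := le_trans (by gcongr; exact measure_iUnion_le _) hLB
      rw [h, ENNReal.mul_top hL0] at h1
      exact hAbt (top_le_iff.1 h1)
    refine lt_of_le_of_lt (measure_mono (t := ball x ρ ∪ W) ?_)
      (lt_of_le_of_lt (measure_union_le _ _) (ENNReal.add_lt_top.2 ⟨hbt.lt_top, hWt.lt_top⟩))
    intro y hy
    by_contra hcon
    rw [mem_union, not_or] at hcon
    apply hy
    rw [hGW y hcon.2]
    simp [indicator, hsupp y hcon.1]
  -- exceptional set
  set E : Set X := ⋃ j : u, ball (j : X) (16 * s j) with hE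
  have hEm : MeasurableSet E := MeasurableSet.iUnion fun j => measurableSet_ball
  refine ⟨E, hEm, ?_, ?_⟩
  · have h1 : μ E ≤ 2 ^ (4 * a) * ∑' j, μ (B j) := by
      rw [← ENNReal.tsum_mul_left]
      refine (measure_iUnion_le _).trans (ENNReal.tsum_le_tsum fun j => ?_)
      refine le_trans ?_ (mul_le_mul' le_rfl (hBball j))
      exact cot_cmp doubling 4 (hspos j j.2) (by simp; norm_num)
    have h2 : A * (2 ^ (2 * a) * μ E) ≤ A * b := by
      calc _ ≤ A * (2 ^ (2 * a) * (2 ^ (4 * a) * ∑' j, μ (B j))) := by gcongr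
        _ = L * ∑' j, μ (B j) := by rw [hL]; ring
        _ ≤ _ := hLB
    exact (ENNReal.mul_le_mul_iff_right hA0 hAt).1 h2
  -- splitting
  set F := ball x ρ \ E with hF
  have hFm : MeasurableSet F := measurableSet_ball.diff hEm
  have hsplit : ∀ z ∈ F, ‖czOperator μ K r f z‖ₑ ≤ ‖czOperator μ K r G z‖ₑ +
      ∑' j : u, cotPhi μ a r (5 * s j) (j : X) z * (2 * m j) := by
    intro z hz
    have i1 := cot_int hμ doubling hK hK_size hr z hfint
    have i2 := cot_int hμ doubling hK hK_size hr z hGint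
    have hzj : ∀ j : u, 16 * s j ≤ dist z j := by
      intro j
      by_contra! hcon
      exact hz.2 (mem_iUnion.2 ⟨j, hcon⟩)
    have s1 : HasSum (fun j => ∫ y in Q j, cotK K r z y * f y ∂μ)
        (∫ y in U, cotK K r z y * f y ∂μ) := by
      rw [← hQU]
      exact hasSum_integral_iUnion hQm hQd i1.integrableOn
    have s2 : HasSum (fun j => ∫ y in B j, cotK K r z y * G y ∂μ)
        (∫ y in W, cotK K r z y * G y ∂μ) := hasSum_integral_iUnion hBm hBd i2.integrableOn
    have hdec : czOperator μ K r f z = czOperator μ K r G z +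
        (∫ y in U, cotK K r z y * f y ∂μ - ∫ y in W, cotK K r z y * G y ∂μ) := by
      rw [cot_op_eq, cot_op_eq, ← integral_add_compl hUm i1, ← integral_add_compl hWm i2]
      have : ∫ y in Wᶜ, cotK K r z y * G y ∂μ = ∫ y in Uᶜ, cotK K r z y * f y ∂μ := by
        rw [← integral_indicator hWm.compl, ← integral_indicator hUm.compl]
        congr 1
        ext y
        by_cases hyW : y ∈ W
        · rw [indicator_of_notMem (by simpa using hyW),
            indicator_of_notMem (by simpa using hWU hyW)]
        · rw [indicator_of_mem (show y ∈ Wᶜ from hyW), hGW y hyW]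
          by_cases hyU : y ∈ U
          · rw [indicator_of_notMem (by simpa using hyU), indicator_of_notMem (by simpa using hyU),
              mul_zero]
          · rw [indicator_of_mem (show y ∈ Uᶜ from hyU), indicator_of_mem (show y ∈ Uᶜ from hyU)]
      rw [this]
      ring
    rw [hdec]
    refine (enorm_add_le _ _).trans ?_
    gcongr
    rw [← (s1.sub s2).tsum_eq]
    refine (enorm_tsum_le_tsum_enorm).trans (ENNReal.tsum_le_tsum fun j => ?_)
    have e : ∫ y in B j, cotK K r z y * G y ∂μ = ∫ y in B j, cotK K r z y * c j ∂μ :=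
      setIntegral_congr_fun (hBm j) (fun y hy => by simp only [hGB j y hy])
    rw [e]
    have hp := hspos j j.2
    have hb5 : ∀ y ∈ V j, ‖cotK K r z y - cotK K r z j‖ₑ ≤ cotPhi μ a r (5 * s j) (j : X) z := by
      intro y hy
      refine cotPhi_bound doubling hK_size hK_smooth_y hr (by positivity) ?_ ?_
      · rw [dist_comm]; exact hy
      · linarith [hzj j]
    refine cot_bracket (hQm j) (hBm j) hfint i1 ?_ (fun y hy => hb5 y (hQV j hy))
      (fun y hy => hb5 y (hBV j hy)) (hBt j) (hc1 j) (hc2 j) le_rfl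
    have i3 : Integrable ((B j).indicator (fun _ => (1 : ℂ))) μ :=
      (integrable_indicator_iff (hBm j)).2 (integrableOn_const (hBt j))
    have i4 := cot_int hμ doubling hK hK_size hr z i3
    refine (i4.integrableOn (s := B j)).congr_fun (fun y hy => ?_) (hBm j)
    simp only [indicator_of_mem hy, mul_one]
  have hTGm : StronglyMeasurable (czOperator μ K r G) := cot_op_meas hK r hGm
  have hgood : ∫⁻ z in F, ‖czOperator μ K r G z‖ₑ ∂μ ≤
      2 ^ (a ^ 3) * 2 ^ (5 * a) * A * b := by
    refine cot_L2 hGL hG1 hAt ?_ hTGm.aestronglyMeasurable (hT G hGm hGbdd hGs)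
      (measure_mono sdiff_subset)
    rw [← pow_mul]
    exact cot_pow (by omega)
  have hbad : ∫⁻ z in F, ∑' j : u, cotPhi μ a r (5 * s j) (j : X) z * (2 * m j) ∂μ ≤
      2 ^ (a ^ 3 + 4 * a) * (2 * (A * b)) := by
    rw [lintegral_tsum (fun j => ((cotPhi_meas r _ _).mul_const _).aemeasurable)]
    calc _ ≤ ∑' j : u, 2 ^ (a ^ 3 + 4 * a) * (2 * m j) := by
          refine ENNReal.tsum_le_tsum fun j => ?_
          have hp := hspos j j.2
          rw [lintegral_mul_const _ (cotPhi_meas r _ _)]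
          gcongr
          refine le_trans (lintegral_mono_set ?_)
            (cotPhi_int hμ ha doubling hr (s := 5 * s j) (by positivity) (j : X))
          intro z hz
          by_contra hcon
          have hcon : ¬ (5 * s j ≤ dist z j) := hcon
          refine hz.2 (mem_iUnion.2 ⟨j, ?_⟩)
          rw [mem_ball]
          linarith
      _ = 2 ^ (a ^ 3 + 4 * a) * (2 * ∑' j, m j) := by
        rw [ENNReal.tsum_mul_left, ENNReal.tsum_mul_left]
      _ ≤ _ := by gcongr
  calc _ ≤ ∫⁻ z in F, (‖czOperator μ K r G z‖ₑ +
      ∑' j : u, cotPhi μ a r (5 * s j) (j : X) z * (2 * m j)) ∂μ :=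
        setLIntegral_mono' hFm hsplit
    _ = ∫⁻ z in F, ‖czOperator μ K r G z‖ₑ ∂μ +
      ∫⁻ z in F, ∑' j : u, cotPhi μ a r (5 * s j) (j : X) z * (2 * m j) ∂μ :=
        lintegral_add_left hTGm.enorm _
    _ ≤ 2 ^ (a ^ 3) * 2 ^ (5 * a) * A * b + 2 ^ (a ^ 3 + 4 * a) * (2 * (A * b)) :=
        add_le_add hgood hbad
    _ = (2 ^ (a ^ 3 + 5 * a) + 2 ^ (a ^ 3 + 4 * a + 1)) * (A * b) := by ring
    _ ≤ (2 ^ (a ^ 3 + 5 * a) + 2 ^ (a ^ 3 + 5 * a)) * (A * b) :=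
        mul_le_mul' (add_le_add le_rfl (cot_pow (by omega))) le_rfl
    _ = 2 ^ (a ^ 3 + 5 * a + 1) * (A * b) := by ring
    _ ≤ _ := mul_le_mul' (cot_pow (by omega)) le_rfl

end CotlarAux

section CotlarAux

open Set Filter Topology

variable {X : Type*} [MetricSpace X] [MeasurableSpace X] {μ : Measure X} {a : ℕ}

lemma cot_max [IsLocallyFiniteMeasure μ] (hμ : μ ≠ 0)
    (doubling : ∀ (x : X) (R : ℝ), 0 < R → μ (ball x (2 * R)) ≤ 2 ^ a * μ (ball x R))
    (w : X → ℂ) (x : X) {t : ℝ} (ht : 0 < t) :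
    ∫⁻ z in ball x t, ‖w z‖ₑ ∂μ ≤ maximalFunction μ w x * μ (ball x t) := by
  have h1 : (μ (ball x t))⁻¹ * ∫⁻ y in ball x t, (‖w y‖₊ : ℝ≥0∞) ∂μ ≤ maximalFunction μ w x := by
    unfold maximalFunction
    exact le_iSup_of_le x (le_iSup_of_le t (le_iSup_of_le (mem_ball_self ht) le_rfl))
  have h0 := cot_pos hμ doubling x ht
  have hf := cot_fin doubling x t
  calc _ = ((μ (ball x t))⁻¹ * ∫⁻ y in ball x t, (‖w y‖₊ : ℝ≥0∞) ∂μ) * μ (ball x t) := by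
        rw [mul_comm, ← mul_assoc, ENNReal.mul_inv_cancel h0 hf, one_mul]
        rfl
    _ ≤ _ := by gcongr

lemma cot_core [BorelSpace X] [SecondCountableTopology X] [SigmaFinite μ]
    [IsLocallyFiniteMeasure μ]
    (hμ : μ ≠ 0) (ha : 4 ≤ a)
    (doubling : ∀ (x : X) (R : ℝ), 0 < R → μ (ball x (2 * R)) ≤ 2 ^ a * μ (ball x R))
    {K : X → X → ℂ} (hK : Measurable (Function.uncurry K))
    (hK_size : ∀ x y, x ≠ y →
      (‖K x y‖₊ : ℝ≥0∞) ≤ 2 ^ (a ^ 3) / μ (ball x (dist x y)))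
    (hK_smooth_y : ∀ x y y', x ≠ y → 2 * dist y y' ≤ dist x y →
      (‖K x y - K x y'‖₊ : ℝ≥0∞) ≤
        ENNReal.ofReal ((dist y y' / dist x y) ^ (1 / (a : ℝ))) *
          (2 ^ (a ^ 3) / μ (ball x (dist x y))))
    (hK_smooth_x : ∀ x x' y, x ≠ y → 2 * dist x x' ≤ dist x y →
      (‖K x y - K x' y‖₊ : ℝ≥0∞) ≤
        ENNReal.ofReal ((dist x x' / dist x y) ^ (1 / (a : ℝ))) *
          (2 ^ (a ^ 3) / μ (ball x (dist x y))))
    {r R : ℝ} (hr : 0 < r) (hrR : r ≤ R)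
    (hT : ∀ g : X → ℂ, Measurable g → (∃ C, ∀ x, ‖g x‖ ≤ C) →
      μ (Function.support g) < ⊤ →
      eLpNorm (czOperator μ K r g) 2 μ ≤ 2 ^ (a ^ 3) * eLpNorm g 2 μ)
    {g : X → ℂ} (hg : Measurable g) (hgb : ∃ C, ∀ x, ‖g x‖ ≤ C)
    (hgs : μ (Function.support g) < ⊤) (x : X) {A : ℝ≥0∞} (hA0 : A ≠ 0) (hAt : A ≠ ⊤)
    (hA : ∀ t : ℝ, 0 < t → ∫⁻ z in ball x t, ‖g z‖ₑ ∂μ ≤ A * μ (ball x t)) :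
    ‖czOperator μ K R g x‖ₑ ≤
      2 ^ 2 * maximalFunction μ (czOperator μ K r g) x + 2 ^ (a ^ 3 + 22 * a + 3) * A := by
  have hR : 0 < R := by linarith
  set M := maximalFunction μ (czOperator μ K r g) x with hM
  have hgint : Integrable g μ := by
    obtain ⟨C, hC⟩ := hgb
    have : IntegrableOn g (Function.support g) μ :=
      Measure.integrableOn_of_bounded (M := C) hgs.ne hg.aestronglyMeasurable
        (Eventually.of_forall hC)
    exact (integrableOn_iff_integrable_of_support_subset subset_rfl).1 this
  set f := (ball x (R / 2)).indicator g with hf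
  set g1 := (ball x (R / 2))ᶜ.indicator g with hg1
  have hfm : Measurable f := hg.indicator measurableSet_ball
  have hfint : Integrable f μ := hgint.indicator measurableSet_ball
  have hg1int : Integrable g1 μ := hgint.indicator measurableSet_ball.compl
  have hfA : ∫⁻ y, ‖f y‖ₑ ∂μ ≤ A * μ (ball x (R / 2)) := by
    refine le_trans (le_of_eq ?_) (hA (R / 2) (by positivity))
    rw [← lintegral_indicator measurableSet_ball]
    congr 1
    ext y
    rw [hf, enorm_indicator_eq_indicator_enorm]
  obtain ⟨E, hEm, hE1, hE2⟩ := cot_weak hμ ha doubling hK hK_size hK_smooth_y hr hT hfm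
    (by
      obtain ⟨C, hC⟩ := hgb
      exact ⟨C, fun y => (norm_indicator_le_norm_self g y).trans (hC y)⟩)
    (x := x) (ρ := R / 2) (by positivity) (fun y hy => indicator_of_notMem hy _) hA0 hAt hfA
  set B := ball x (R / 4) with hB
  have hBt : μ B ≠ ⊤ := cot_fin doubling x _
  have hB0 : μ B ≠ 0 := cot_pos hμ doubling x (by positivity)
  have hB2 : μ (ball x (R / 2)) ≤ 2 ^ a * μ B := by
    have := doubling x (R / 4) (by positivity)
    rwa [show 2 * (R / 4) = R / 2 by ring] at this
  set F := B \ E with hF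
  have hFm : MeasurableSet F := measurableSet_ball.diff hEm
  have hE3 : 2 * μ E ≤ μ B := by
    have h1 : 2 ^ a * (2 ^ a * μ E) ≤ 2 ^ a * μ B := by
      calc _ = 2 ^ (2 * a) * μ E := by ring
        _ ≤ _ := hE1.trans hB2
    have h2 := (ENNReal.mul_le_mul_iff_right (pow_ne_zero _ (by simp))
      (ENNReal.pow_ne_top (by simp))).1 h1
    refine le_trans (mul_le_mul' ?_ le_rfl) h2
    calc (2 : ℝ≥0∞) = 2 ^ 1 := by simp
      _ ≤ _ := cot_pow (by omega)
  have hBF : μ B ≤ 2 * μ F := by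
    have h1 : μ B ≤ μ F + μ E := by
      refine (measure_mono (t := F ∪ E) ?_).trans (measure_union_le _ _)
      rw [hF, sdiff_union_self]
      exact subset_union_left
    have h2 : μ B + μ B ≤ 2 * μ F + μ B := by
      calc μ B + μ B = 2 * μ B := by ring
        _ ≤ 2 * (μ F + μ E) := by gcongr
        _ = 2 * μ F + 2 * μ E := by ring
        _ ≤ _ := by gcongr
    exact (ENNReal.add_le_add_iff_right hBt).1 h2
  have pw : ∀ z ∈ F, ‖czOperator μ K R g x‖ₑ ≤ ‖czOperator μ K r g z‖ₑ +
      (‖czOperator μ K r f z‖ₑ + 2 ^ (a ^ 3 + 5 * a) * A) := by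
    intro z hz
    have hxz : dist x z < R / 4 := by rw [dist_comm]; exact hz.1
    have h1 := cot_compare hμ ha doubling hK hK_size hK_smooth_x hr hrR hgint hg hxz hA
    have h2 : czOperator μ K r g z = czOperator μ K r f z + czOperator μ K r g1 z := by
      rw [cot_op_eq, cot_op_eq, cot_op_eq, ← integral_add
        (cot_int hμ doubling hK hK_size hr z hfint) (cot_int hμ doubling hK hK_size hr z hg1int)]
      congr 1
      ext y
      rw [← mul_add, hf, hg1, indicator_self_add_compl_apply]
    have h3 : czOperator μ K R g x = czOperator μ K r g z + (-czOperator μ K r f z +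
        (czOperator μ K R g x - czOperator μ K r g1 z)) := by
      rw [h2]; ring
    calc ‖czOperator μ K R g x‖ₑ = ‖czOperator μ K r g z + (-czOperator μ K r f z +
        (czOperator μ K R g x - czOperator μ K r g1 z))‖ₑ := by rw [← h3]
      _ ≤ ‖czOperator μ K r g z‖ₑ + (‖-czOperator μ K r f z‖ₑ +
        ‖czOperator μ K R g x - czOperator μ K r g1 z‖ₑ) :=
        (enorm_add_le _ _).trans (add_le_add le_rfl (enorm_add_le _ _))
      _ ≤ _ := by
        rw [enorm_neg]
        gcongr
  have hIntF : ‖czOperator μ K R g x‖ₑ * μ F ≤ M * μ B +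
      (2 ^ (a ^ 3 + 6 * a) * (A * (2 ^ a * μ B)) + 2 ^ (a ^ 3 + 5 * a) * A * μ B) := by
    calc _ = ∫⁻ z in F, ‖czOperator μ K R g x‖ₑ ∂μ := (setLIntegral_const _ _).symm
      _ ≤ ∫⁻ z in F, (‖czOperator μ K r g z‖ₑ +
        (‖czOperator μ K r f z‖ₑ + 2 ^ (a ^ 3 + 5 * a) * A)) ∂μ := setLIntegral_mono' hFm pw
      _ = ∫⁻ z in F, ‖czOperator μ K r g z‖ₑ ∂μ + (∫⁻ z in F, ‖czOperator μ K r f z‖ₑ ∂μ +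
          ∫⁻ z in F, 2 ^ (a ^ 3 + 5 * a) * A ∂μ) := by
        rw [lintegral_add_left (cot_op_meas hK r hg).enorm,
          lintegral_add_left (cot_op_meas hK r hfm).enorm]
      _ ≤ _ := by
        refine add_le_add ?_ (add_le_add ?_ ?_)
        · exact (lintegral_mono_set sdiff_subset).trans
            (cot_max hμ doubling _ x (by positivity))
        · refine (lintegral_mono_set (sdiff_subset_sdiff_left
            (ball_subset_ball (by linarith)))).trans (hE2.trans ?_)
          gcongr
        · rw [setLIntegral_const]
          exact mul_le_mul' le_rfl (measure_mono sdiff_subset)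
  have hfinal : ‖czOperator μ K R g x‖ₑ * μ B ≤
      (2 ^ 2 * M + 2 ^ (a ^ 3 + 22 * a + 3) * A) * μ B := by
    calc _ ≤ ‖czOperator μ K R g x‖ₑ * (2 * μ F) := by gcongr
      _ = 2 * (‖czOperator μ K R g x‖ₑ * μ F) := by ring
      _ ≤ 2 * (M * μ B +
        (2 ^ (a ^ 3 + 6 * a) * (A * (2 ^ a * μ B)) + 2 ^ (a ^ 3 + 5 * a) * A * μ B)) := by gcongr
      _ = (2 ^ 1 * M + (2 ^ (a ^ 3 + 7 * a + 1) + 2 ^ (a ^ 3 + 5 * a + 1)) * A) * μ B := by ring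
      _ ≤ (2 ^ 2 * M + (2 ^ (a ^ 3 + 22 * a + 2) + 2 ^ (a ^ 3 + 22 * a + 2)) * A) * μ B := by
        refine mul_le_mul' (add_le_add (mul_le_mul' (cot_pow (by omega)) le_rfl)
          (mul_le_mul' (add_le_add (cot_pow (by omega)) (cot_pow (by omega))) le_rfl)) le_rfl
      _ = _ := by ring
  exact (ENNReal.mul_le_mul_iff_left hB0 hBt).1 hfinal

end CotlarAux

/-- **Cotlar's estimate**: in a doubling metric measure space `(X, ρ, μ, a)` with `a ≥ 4` and a
two-sided Calderón–Zygmund kernel `K`, if `T_r` is bounded on `L²` with constant `2^{a³}`, then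
for all `0 < r ≤ R`, every `x`, and every bounded measurable `g` supported on a set of finite
measure, `|T_R g(x)| ≤ 2² M(T_r g)(x) + 2^{a³+22a+3} M g(x)`. -/
theorem cotlar_estimate
    {X : Type*} [MetricSpace X] [CompleteSpace X] [LocallyCompactSpace X]
    [MeasurableSpace X] [BorelSpace X]
    (μ : Measure X) [IsLocallyFiniteMeasure μ] (hμ : μ ≠ 0)
    {a : ℕ} (ha : 4 ≤ a)
    (doubling : ∀ (x : X) (R : ℝ), 0 < R → μ (ball x (2 * R)) ≤ 2 ^ a * μ (ball x R))
    {K : X → X → ℂ} (hK_meas : Measurable (Function.uncurry K))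
    (hK_size : ∀ x y, x ≠ y →
      (‖K x y‖₊ : ℝ≥0∞) ≤ 2 ^ (a ^ 3) / μ (ball x (dist x y)))
    (hK_smooth_y : ∀ x y y', x ≠ y → 2 * dist y y' ≤ dist x y →
      (‖K x y - K x y'‖₊ : ℝ≥0∞) ≤
        ENNReal.ofReal ((dist y y' / dist x y) ^ (1 / (a : ℝ))) *
          (2 ^ (a ^ 3) / μ (ball x (dist x y))))
    (hK_smooth_x : ∀ x x' y, x ≠ y → 2 * dist x x' ≤ dist x y →
      (‖K x y - K x' y‖₊ : ℝ≥0∞) ≤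
        ENNReal.ofReal ((dist x x' / dist x y) ^ (1 / (a : ℝ))) *
          (2 ^ (a ^ 3) / μ (ball x (dist x y))))
    {r R : ℝ} (hr : 0 < r) (hrR : r ≤ R)
    (hT : ∀ g : X → ℂ, Measurable g → (∃ C, ∀ x, ‖g x‖ ≤ C) →
      μ (Function.support g) < ⊤ →
      eLpNorm (czOperator μ K r g) 2 μ ≤ 2 ^ (a ^ 3) * eLpNorm g 2 μ)
    {g : X → ℂ} (hg_meas : Measurable g) (hg_bdd : ∃ C, ∀ x, ‖g x‖ ≤ C)
    (hg_supp : μ (Function.support g) < ⊤) (x : X) :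
    (‖czOperator μ K R g x‖₊ : ℝ≥0∞) ≤
      2 ^ 2 * maximalFunction μ (czOperator μ K r g) x +
        2 ^ (a ^ 3 + 22 * a + 3) * maximalFunction μ g x := by
  have := cot_secondCountable hμ doubling x
  have := cot_sigmaFinite doubling x
  have hmax := fun (t : ℝ) (ht : 0 < t) => cot_max hμ doubling g x ht
  rcases eq_or_ne (maximalFunction μ g x) ⊤ with htop | htop
  · rw [htop, ENNReal.mul_top (pow_ne_zero _ (by simp)), add_top]
    exact le_top
  rcases eq_or_ne (maximalFunction μ g x) 0 with h0 | h0
  · rw [h0, mul_zero, add_zero]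
    apply ENNReal.le_of_forall_pos_le_add
    intro ε hε _
    have hC0 : (2 : ℝ≥0∞) ^ (a ^ 3 + 22 * a + 3) ≠ 0 := pow_ne_zero _ (by simp)
    have hCt : (2 : ℝ≥0∞) ^ (a ^ 3 + 22 * a + 3) ≠ ⊤ := ENNReal.pow_ne_top (by simp)
    have hε' : (ε : ℝ≥0∞) ≠ 0 := by simpa using hε.ne'
    have h := cot_core hμ ha doubling hK_meas hK_size hK_smooth_y hK_smooth_x hr hrR hT hg_meas
      hg_bdd hg_supp x (A := ε / 2 ^ (a ^ 3 + 22 * a + 3))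
      (ENNReal.div_pos hε' hCt).ne' (ENNReal.div_ne_top ENNReal.coe_ne_top hC0)
      (fun t ht => (hmax t ht).trans (by rw [h0, zero_mul]; exact zero_le))
    rwa [ENNReal.mul_div_cancel hC0 hCt] at h
  · exact cot_core hμ ha doubling hK_meas hK_size hK_smooth_y hK_smooth_x hr hrR hT hg_meas
      hg_bdd hg_supp x h0 htop hmax
end
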